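/- arXiv:1707.03766 — 4 statements merged into one kernel-verified Lean document; each statement's English description precedes it below -/
import Mathlib

section
/- Let u be an arbitrary word and v, w nonempty words over V. Then u ∨ (vw) = Σ_{u=u¹u²} (u¹ ∨ v)(u² ∨ w), where vw and the juxtaposition on the right denote concatenation and the sum runs over all cuts of u (with the empty-word conventions for the operations). -/
open Finset MonoidAlgebra TensorProduct

/-- `Sh(p,q)`: permutations of the `p+q` indices that are increasing on the
first `p` indices and on the last `q` indices. -/
def IsSh (p q : ℕ) (σ : Equiv.Perm (Fin (p + q))) : Prop :=
  (∀ i j : Fin (p + q), (i : ℕ) < (j : ℕ) → (j : ℕ) < p → σ i < σ j) ∧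
  (∀ i j : Fin (p + q), p ≤ (i : ℕ) → (i : ℕ) < (j : ℕ) → σ i < σ j)

instance IsSh.decPred (p q : ℕ) : DecidablePred (IsSh p q) := fun _ => by
  unfold IsSh; infer_instance

/-- The word `u_{σ⁻¹(1)} u_{σ⁻¹(2)} ⋯ u_{σ⁻¹(p+q)}` where `u₁ ⋯ u_p` is `u` and
`u_{p+1} ⋯ u_{p+q}` is `v`. -/
def shWord {V : Type*} (u v : List V) (σ : Equiv.Perm (Fin (u.length + v.length))) :
    FreeMonoid V :=
  FreeMonoid.ofList
    (List.ofFn fun i => (u ++ v).get (Fin.cast (List.length_append (as := u) (bs := v)).symm (σ.symm i)))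

/-- `posCond p b i` says that the letter at (combined) index `i` comes from the second
word (`b = true`, i.e. `p ≤ i`) or from the first word (`b = false`, i.e. `i < p`). -/
def posCond (p : ℕ) (b : Bool) (i : ℕ) : Prop :=
  match b with
  | true => p ≤ i
  | false => i < p

instance posCond.dec (p : ℕ) (b : Bool) (i : ℕ) : Decidable (posCond p b i) := by
  cases b <;> unfold posCond <;> infer_instance

variable (k : Type*) [CommRing k] {V : Type*}

/-- The shuffle product `u ⧢ v` of two words, as an element of the monoid algebra
`H` of the free monoid on `V` (sum over all `(p,q)`-shuffles); in particular
`1 ⧢ a = a ⧢ 1 = a`. -/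
noncomputable def shuffleProd (u v : List V) : MonoidAlgebra k (FreeMonoid V) :=
  ∑ σ ∈ univ.filter (IsSh u.length v.length),
    MonoidAlgebra.single (shWord u v σ) (1 : k)

/-- Generic quadri-algebra operation on words: the part of the shuffle product `u ⧢ v`
consisting of the shuffles where the first (resp. last) letter comes from `v` iff `fb`
(resp. `lb`) is `true`.  (For a shuffle permutation, the first letter comes from `v`
iff `σ⁻¹(1) = p+1`, and from `u` iff `σ⁻¹(1) = 1`; the last letter comes from `v` iff
`σ⁻¹(p+q) = p+q`, and from `u` iff `σ⁻¹(p+q) = p`.)  This definition also encodes the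
empty-word conventions: `1 ↘ a = a` and `a ↖ 1 = a` for nonempty `a`, and all other
quadri-algebra operations with an empty argument are `0`. -/
noncomputable def quadOp (fb lb : Bool) (u v : List V) : MonoidAlgebra k (FreeMonoid V) :=
  ∑ σ ∈ univ.filter (fun σ : Equiv.Perm (Fin (u.length + v.length)) =>
      IsSh u.length v.length σ ∧
      ∃ h : 0 < u.length + v.length,
        posCond u.length fb (σ.symm ⟨0, h⟩) ∧
        posCond u.length lb (σ.symm ⟨u.length + v.length - 1, Nat.sub_lt h Nat.one_pos⟩)),
    MonoidAlgebra.single (shWord u v σ) (1 : k)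

/-- `u ↘ v` : shuffles whose first and last letters come from `v`. -/
noncomputable def seOp (u v : List V) : MonoidAlgebra k (FreeMonoid V) := quadOp k true true u v

/-- `u ↗ v` : shuffles whose first letter comes from `v` and last letter from `u`. -/
noncomputable def neOp (u v : List V) : MonoidAlgebra k (FreeMonoid V) := quadOp k true false u v

/-- `u ↖ v` : shuffles whose first and last letters come from `u`. -/
noncomputable def nwOp (u v : List V) : MonoidAlgebra k (FreeMonoid V) := quadOp k false false u v

/-- `u ↙ v` : shuffles whose first letter comes from `u` and last letter from `v`. -/
noncomputable def swOp (u v : List V) : MonoidAlgebra k (FreeMonoid V) := quadOp k false true u v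

/-- `u ≻ v := u ↗ v + u ↘ v`. -/
noncomputable def succOp (u v : List V) : MonoidAlgebra k (FreeMonoid V) := neOp k u v + seOp k u v

/-- `u ≺ v := u ↖ v + u ↙ v`. -/
noncomputable def precOp (u v : List V) : MonoidAlgebra k (FreeMonoid V) := nwOp k u v + swOp k u v

/-- `u ∨ v := u ↘ v + u ↙ v`. -/
noncomputable def veeOp (u v : List V) : MonoidAlgebra k (FreeMonoid V) := seOp k u v + swOp k u v

/-- `u ∧ v := u ↗ v + u ↖ v`. -/
noncomputable def wedgeOp (u v : List V) : MonoidAlgebra k (FreeMonoid V) := neOp k u v + nwOp k u v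

/-- Condition on the inverse of a shuffle. -/
def CondT (p n : ℕ) (τ : Equiv.Perm (Fin n)) : Prop :=
  (∀ a b : Fin n, (τ a : ℕ) < τ b → ((τ b : ℕ) < p ∨ p ≤ (τ a : ℕ)) → (a : ℕ) < b) ∧
  (∀ a : Fin n, (a : ℕ) + 1 = n → p ≤ (τ a : ℕ))

open Classical in
/-- Cast-free version of `veeOp`. -/
noncomputable def GG (p n : ℕ) (f : Fin n → V) : MonoidAlgebra k (FreeMonoid V) :=
  ∑ τ : Equiv.Perm (Fin n), if CondT p n τ then
    MonoidAlgebra.single (FreeMonoid.ofList (List.ofFn fun i => f (τ i))) (1 : k) else 0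

lemma GG_cast {p n m : ℕ} (h : n = m) (f : Fin n → V) (g : Fin m → V)
    (hfg : ∀ i : Fin n, f i = g (Fin.cast h i)) : GG k p n f = GG k p m g := by
  subst h
  congr 1
  funext i
  exact hfg i

/-- Extend a permutation by a prescribed first value. -/
noncomputable def extP {n : ℕ} (j : Fin (n + 1)) (ρ : Equiv.Perm (Fin n)) :
    Equiv.Perm (Fin (n + 1)) :=
  Equiv.ofBijective (Fin.cons j (fun i => j.succAbove (ρ i)) : Fin (n + 1) → Fin (n + 1)) (by
    apply Finite.injective_iff_bijective.mp
    intro a b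
    refine Fin.cases ?_ (fun a => ?_) a <;> refine Fin.cases ?_ (fun b => ?_) b
    · simp
    · simp only [Fin.cons_zero, Fin.cons_succ]
      intro h; exact absurd h.symm (Fin.succAbove_ne _ _)
    · simp only [Fin.cons_zero, Fin.cons_succ]
      intro h; exact absurd h (Fin.succAbove_ne _ _)
    · simp)

@[simp] lemma extP_zero {n : ℕ} (j : Fin (n + 1)) (ρ : Equiv.Perm (Fin n)) :
    extP j ρ 0 = j := rfl

@[simp] lemma extP_succ {n : ℕ} (j : Fin (n + 1)) (ρ : Equiv.Perm (Fin n)) (i : Fin n) :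
    extP j ρ i.succ = j.succAbove (ρ i) := rfl

lemma extP_bij (n : ℕ) : Function.Bijective
    (fun x : Fin (n + 1) × Equiv.Perm (Fin n) => extP x.1 x.2) := by
  rw [Fintype.bijective_iff_injective_and_card]
  constructor
  · rintro ⟨j, ρ⟩ ⟨j', ρ'⟩ h
    have h0 := Equiv.congr_fun h 0
    simp only [extP_zero] at h0
    subst h0
    have : ρ = ρ' := by
      ext i
      have := Equiv.congr_fun h i.succ
      simp only [extP_succ] at this
      rw [Fin.succAbove_right_injective this]
    rw [this]
  · simp [Fintype.card_perm, Nat.factorial_succ]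

lemma succAbove_val {n : ℕ} (j : Fin (n + 1)) (i : Fin n) :
    ((j.succAbove i : Fin (n + 1)) : ℕ) = if (i : ℕ) < j then (i : ℕ) else i + 1 := by
  simp only [Fin.succAbove, Fin.lt_def]
  split_ifs <;> simp_all

lemma cond_ext_zero {p n : ℕ} (hn : 1 ≤ n) (ρ : Equiv.Perm (Fin n)) :
    CondT (p + 1) (n + 1) (extP 0 ρ) ↔ CondT p n ρ := by
  simp only [CondT, Fin.forall_fin_succ, extP_zero, extP_succ, succAbove_val, Fin.val_succ,
    Fin.val_zero]
  grind

lemma cond_ext_mid {p n : ℕ} (hn : p + 1 ≤ n) (ρ : Equiv.Perm (Fin n)) :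
    CondT (p + 1) (n + 1) (extP ⟨p + 1, by omega⟩ ρ) ↔ CondT (p + 1) n ρ := by
  simp only [CondT, Fin.forall_fin_succ, extP_zero, extP_succ, succAbove_val, Fin.val_succ,
    Fin.val_zero]
  grind

lemma cond_ext_other {p n : ℕ} (hn : p + 1 ≤ n) (j : Fin (n + 1)) (h0 : (j : ℕ) ≠ 0)
    (h1 : (j : ℕ) ≠ p + 1) (ρ : Equiv.Perm (Fin n)) :
    ¬ CondT (p + 1) (n + 1) (extP j ρ) := by
  rintro ⟨h, -⟩
  by_cases hj : (j : ℕ) < p + 1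
  · have := h ((extP j ρ).symm 0) 0
      (by rw [Equiv.apply_symm_apply, extP_zero, Fin.val_zero]; omega) (by simp; omega)
    simp at this
  · have := h ((extP j ρ).symm ⟨p + 1, by omega⟩) 0 (by simp; omega) (by simp)
    simp at this

lemma GG_rec {p n : ℕ} (hn : p + 1 ≤ n) (f : Fin (n + 1) → V) :
    GG k (p + 1) (n + 1) f =
      single (FreeMonoid.of (f 0)) (1 : k) * GG k p n (fun i => f i.succ) +
      single (FreeMonoid.of (f ⟨p + 1, by omega⟩)) (1 : k) *
        GG k (p + 1) n (fun i => f (Fin.succAbove ⟨p + 1, by omega⟩ i)) := by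
  classical
  have key : ∀ (j : Fin (n + 1)) (ρ : Equiv.Perm (Fin n)),
      single (FreeMonoid.ofList (List.ofFn fun i => f (extP j ρ i))) (1 : k) =
      single (FreeMonoid.of (f j)) (1 : k) *
        single (FreeMonoid.ofList (List.ofFn fun i => f (j.succAbove (ρ i)))) (1 : k) := by
    intro j ρ
    rw [MonoidAlgebra.single_mul_single, one_mul, List.ofFn_succ]
    rfl
  have hne : (0 : Fin (n + 1)) ≠ ⟨p + 1, by omega⟩ := by
    simp [Fin.ext_iff]
  unfold GG
  rw [← (extP_bij n).sum_comp, Fintype.sum_prod_type]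
  rw [Fintype.sum_eq_add (0 : Fin (n + 1)) ⟨p + 1, by omega⟩ hne]
  · simp only [cond_ext_zero (p := p) (by omega : 1 ≤ n), cond_ext_mid hn, key, Finset.mul_sum,
      mul_ite, mul_zero, Fin.succAbove_zero]
  · rintro j ⟨h0, h1⟩
    refine Finset.sum_eq_zero fun ρ _ => ?_
    rw [if_neg]
    refine cond_ext_other hn j ?_ ?_ ρ
    · intro h; exact h0 (Fin.ext h)
    · intro h; exact h1 (Fin.ext h)

lemma vee_eq_GG (u v : List V) (h : 0 < u.length + v.length) :
    veeOp k u v = GG k u.length (u.length + v.length)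
      (fun i => (u ++ v).get (Fin.cast List.length_append.symm i)) := by
  classical
  unfold veeOp seOp swOp quadOp GG
  simp only [Finset.sum_filter]
  rw [← Finset.sum_add_distrib]
  refine Fintype.sum_bijective _ (Equiv.symm_bijective (α := Fin (u.length + v.length))
    (β := Fin (u.length + v.length))) _ _ fun σ => ?_
  have hc : CondT u.length (u.length + v.length) σ.symm ↔ (IsSh u.length v.length σ ∧
      u.length ≤ (σ.symm ⟨u.length + v.length - 1, Nat.sub_lt h Nat.one_pos⟩ : ℕ)) := by
    unfold CondT IsSh
    constructor
    · rintro ⟨h1, h2⟩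
      refine ⟨⟨fun i j hij hj => ?_, fun i j hi hij => ?_⟩, h2 _ (by simp; omega)⟩
      · have := h1 (σ i) (σ j); simp at this; exact this hij (Or.inl hj)
      · have := h1 (σ i) (σ j); simp at this; exact this hij (Or.inr hi)
    · rintro ⟨⟨h1, h2⟩, h3⟩
      refine ⟨fun a b hab hh => ?_, fun a ha => ?_⟩
      · rcases hh with hh | hh
        · simpa using h1 _ _ hab hh
        · simpa using h2 _ _ hh hab
      · convert h3
        omega
  simp only [hc, posCond, h, exists_true_left, shWord]
  by_cases hs : IsSh u.length v.length σ <;>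
  by_cases h4 : u.length ≤ (σ.symm ⟨u.length + v.length - 1, Nat.sub_lt h Nat.one_pos⟩ : ℕ) <;>
  by_cases h5 : u.length ≤ (σ.symm ⟨0, h⟩ : ℕ) <;>
  simp [hs, h4, h5, not_lt.mpr, not_le.mp]

lemma vee_nil_right (u : List V) : veeOp k u [] = 0 := by
  rcases Nat.eq_zero_or_pos u.length with h | h
  · rw [List.length_eq_zero_iff] at h
    subst h
    unfold veeOp seOp swOp quadOp
    simp
  · rw [vee_eq_GG k u [] (by simpa using h)]
    refine Finset.sum_eq_zero fun τ _ => ?_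
    rw [if_neg]
    rintro ⟨-, h2⟩
    have := h2 ⟨u.length - 1, by simp; omega⟩ (by simp; omega)
    have h3 := (τ ⟨u.length - 1, by simp; omega⟩).isLt
    simp only [List.length_nil] at *
    omega

lemma vee_nil_left (v : List V) (hv : v ≠ []) :
    veeOp k [] v = single (FreeMonoid.ofList v) (1 : k) := by
  classical
  have hl : 0 < v.length := List.length_pos_iff.mpr hv
  rw [vee_eq_GG k [] v (by simpa using hl)]
  unfold GG
  rw [Fintype.sum_eq_single (1 : Equiv.Perm (Fin (([] : List V).length + v.length)))]
  · rw [if_pos]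
    · congr 2
      apply List.ext_getElem
      · simp
      · intro i h1 h2
        simp
    · refine ⟨?_, ?_⟩ <;> simp
  · intro τ hτ
    rw [if_neg]
    rintro ⟨h, -⟩
    apply hτ
    have hm : StrictMono τ.symm := by
      intro a b hab
      have := h (τ.symm a) (τ.symm b)
      simp at this
      exact this hab
    have h6 : τ.symm = 1 := by
      have h7 := Subsingleton.elim (hm.orderIsoOfSurjective _ τ.symm.surjective) (OrderIso.refl _)
      ext i
      exact congrArg Fin.val (DFunLike.congr_fun h7 i)
    have := congrArg Equiv.symm h6
    exact this

lemma vee_cons (a b : V) (u v : List V) :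
    veeOp k (a :: u) (b :: v) =
      single (FreeMonoid.of a) (1 : k) * veeOp k u (b :: v) +
      single (FreeMonoid.of b) (1 : k) * veeOp k (a :: u) v := by
  rw [vee_eq_GG k (a :: u) (b :: v) (by simp), vee_eq_GG k u (b :: v) (by simp),
    vee_eq_GG k (a :: u) v (by simp)]
  have := GG_rec k (p := u.length) (n := u.length + 1 + v.length) (by omega)
    (fun i => (a :: u ++ b :: v).get
      (Fin.cast (by simp; omega) i))
  refine Eq.trans ?_ (this.trans ?_)
  · exact GG_cast k (by simp; omega) _ _ (fun i => rfl)
  · congr 2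
    · exact GG_cast k (by simp; omega) _ _ (fun i => by simp)
    · simp
    · refine GG_cast k (by simp) _ _ (fun i => ?_)
      simp only [List.get_eq_getElem, Fin.val_cast, succAbove_val]
      split_ifs with hi
      · have hi' : (i : ℕ) < (a :: u).length := by simpa using hi
        rw [List.getElem_append_left hi', List.getElem_append_left hi']
      · have hi' : (a :: u).length ≤ (i : ℕ) := by simpa using hi
        rw [List.getElem_append_right (by omega), List.getElem_append_right hi']
        simp only [Nat.sub_add_comm hi', List.getElem_cons_succ]

theorem statement11 (u v w : List V) (hv : v ≠ []) (hw : w ≠ []) :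
    veeOp k u (v ++ w) =
      ∑ i ∈ Finset.range (u.length + 1),
        veeOp k (u.take i) v * veeOp k (u.drop i) w := by
  induction u generalizing v with
  | nil =>
    simp only [List.length_nil, zero_add, Finset.sum_range_one, List.take_nil, List.drop_nil]
    rw [vee_nil_left k _ hv, vee_nil_left k _ hw, vee_nil_left k _ (by simp [hv]),
      MonoidAlgebra.single_mul_single, one_mul]
    rfl
  | cons a u ihu =>
    induction v with
    | nil => exact absurd rfl hv
    | cons b v ihv =>
      rw [List.cons_append, vee_cons, ← List.cons_append, ihu (b :: v) (by simp)]
      conv_rhs => rw [List.length_cons, Finset.sum_range_succ']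
      simp only [List.length_cons, List.take_succ_cons, List.drop_succ_cons, List.take_zero,
        List.drop_zero, vee_cons, add_mul, Finset.sum_add_distrib, mul_assoc, ← Finset.mul_sum]
      rw [add_assoc]
      congr 1
      by_cases h : v = []
      · subst h
        simp only [List.nil_append, vee_nil_right, zero_mul, Finset.sum_const_zero, mul_zero,
          zero_add]
        rw [vee_nil_left k _ (by simp)]
        rfl
      · rw [ihv h, Finset.sum_range_succ']
        simp only [List.length_cons, List.take_succ_cons, List.drop_succ_cons, List.take_zero,
          List.drop_zero, mul_add]
        congr 1
        rw [vee_nil_left k _ h, vee_nil_left k _ (by simp), ← mul_assoc,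
          MonoidAlgebra.single_mul_single, one_mul]
        rfl
end

section
/- For all nonempty words x, y, z over V, the four shuffle operations satisfy the nine Aguiar–Loday quadri-algebra axioms: (x↖y)↖z = x↖(y⋆z); (x↗y)↖z = x↗(y≺z); (x∧y)↗z = x↗(y≻z); (x↙y)↖z = x↙(y∧z); (x↘y)↖z = x↘(y↖z); (x∨y)↗z = x↘(y↗z); (x≺y)↙z = x↙(y∨z); (x≻y)↙z = x↘(y↙z); and (x⋆y)↘z = x↘(y↘z), where x⋆y := x↗y + x↘y + x↖y + x↙y. -/
open Finset MonoidAlgebra TensorProduct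

variable (k : Type*) [CommRing k] {V : Type*}

/-- `x ⋆ y := x ↗ y + x ↘ y + x ↖ y + x ↙ y`. -/
noncomputable def starOp (u v : List V) : MonoidAlgebra k (FreeMonoid V) :=
  neOp k u v + seOp k u v + nwOp k u v + swOp k u v

/-- The word `u`, viewed as an element of the monoid algebra. -/
noncomputable def wordElt (u : List V) : MonoidAlgebra k (FreeMonoid V) :=
  MonoidAlgebra.single (FreeMonoid.ofList u) (1 : k)

/-- `k`-bilinear extension of a word-level operation to the monoid algebra. -/
noncomputable def liftB (f : FreeMonoid V → FreeMonoid V → MonoidAlgebra k (FreeMonoid V))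
    (x y : MonoidAlgebra k (FreeMonoid V)) : MonoidAlgebra k (FreeMonoid V) :=
  Finsupp.sum x.coeff fun a ca => Finsupp.sum y.coeff fun b cb => (ca * cb) • f a b

/-- `↘`, extended `k`-bilinearly to the monoid algebra. -/
noncomputable def seH : MonoidAlgebra k (FreeMonoid V) → MonoidAlgebra k (FreeMonoid V) →
    MonoidAlgebra k (FreeMonoid V) :=
  liftB k fun a b => seOp k (FreeMonoid.toList a) (FreeMonoid.toList b)

/-- `↗`, extended `k`-bilinearly to the monoid algebra. -/
noncomputable def neH : MonoidAlgebra k (FreeMonoid V) → MonoidAlgebra k (FreeMonoid V) →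
    MonoidAlgebra k (FreeMonoid V) :=
  liftB k fun a b => neOp k (FreeMonoid.toList a) (FreeMonoid.toList b)

/-- `↖`, extended `k`-bilinearly to the monoid algebra. -/
noncomputable def nwH : MonoidAlgebra k (FreeMonoid V) → MonoidAlgebra k (FreeMonoid V) →
    MonoidAlgebra k (FreeMonoid V) :=
  liftB k fun a b => nwOp k (FreeMonoid.toList a) (FreeMonoid.toList b)

/-- `↙`, extended `k`-bilinearly to the monoid algebra. -/
noncomputable def swH : MonoidAlgebra k (FreeMonoid V) → MonoidAlgebra k (FreeMonoid V) →
    MonoidAlgebra k (FreeMonoid V) :=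
  liftB k fun a b => swOp k (FreeMonoid.toList a) (FreeMonoid.toList b)

/-- `≻ = ↗ + ↘` on the monoid algebra. -/
noncomputable def succH (x y : MonoidAlgebra k (FreeMonoid V)) : MonoidAlgebra k (FreeMonoid V) :=
  neH k x y + seH k x y

/-- `≺ = ↖ + ↙` on the monoid algebra. -/
noncomputable def precH (x y : MonoidAlgebra k (FreeMonoid V)) : MonoidAlgebra k (FreeMonoid V) :=
  nwH k x y + swH k x y

/-- `∨ = ↘ + ↙` on the monoid algebra. -/
noncomputable def veeH (x y : MonoidAlgebra k (FreeMonoid V)) : MonoidAlgebra k (FreeMonoid V) :=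
  seH k x y + swH k x y

/-- `∧ = ↗ + ↖` on the monoid algebra. -/
noncomputable def wedgeH (x y : MonoidAlgebra k (FreeMonoid V)) : MonoidAlgebra k (FreeMonoid V) :=
  neH k x y + nwH k x y

namespace QA

/-- merge two words along a colour sequence -/
def mergeW {V : Type*} : List Bool → List V → List V → List V
  | false :: c, a :: u, v => a :: mergeW c u v
  | true :: c, u, b :: v => b :: mergeW c u v
  | _, _, _ => []

/-- colour sequences -/
def C (p q : ℕ) : Finset (List Bool) :=
  (List.replicate p false ++ List.replicate q true).permutations.toFinset

lemma mem_C {p q : ℕ} {c : List Bool} : c ∈ C p q ↔ c.count false = p ∧ c.count true = q := by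
  simp only [C, List.mem_toFinset, List.mem_permutations, List.perm_iff_count]
  simp [List.count_append, List.count_replicate]

/-- three-coloured sequences -/
def D (p q r : ℕ) : Finset (List (Fin 3)) :=
  (List.replicate p (0 : Fin 3) ++ (List.replicate q 1 ++ List.replicate r 2)).permutations.toFinset

lemma mem_D {p q r : ℕ} {d : List (Fin 3)} :
    d ∈ D p q r ↔ d.count 0 = p ∧ d.count 1 = q ∧ d.count 2 = r := by
  simp only [D, List.mem_toFinset, List.mem_permutations, List.perm_iff_count]
  simp [List.count_append, List.count_replicate, Fin.forall_fin_succ]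

lemma mergeW_filter {V : Type*} (W : List (V × Bool)) :
    mergeW (W.map Prod.snd) ((W.filter (fun a => !a.2)).map Prod.fst)
      ((W.filter (fun a => a.2)).map Prod.fst) = W.map Prod.fst := by
  induction W with
  | nil => simp [mergeW]
  | cons a W ih =>
    obtain ⟨a, b⟩ := a
    cases b <;> simp [mergeW, ih]

lemma filter_sh {n : ℕ} (σ : Equiv.Perm (Fin n)) (P : Fin n → Bool)
    (h : ∀ i j, P i → P j → i < j → σ i < σ j) :
    (List.finRange n).filter (fun i => P (σ.symm i)) = ((List.finRange n).filter P).map σ := by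
  have hs : (List.finRange n).Pairwise (· < ·) := List.pairwise_lt_finRange n
  refine List.Perm.eq_of_pairwise (le := (· < ·)) ?_ (hs.filter _) ?_ ?_
  · intro a b _ _ h1 h2
    exact absurd h1 (not_lt_of_gt h2)
  · rw [List.pairwise_map]
    refine List.Pairwise.imp_of_mem ?_ (hs.filter P)
    intro a b ha hb hab
    exact h a b (List.mem_filter.1 ha).2 (List.mem_filter.1 hb).2 hab
  · rw [List.perm_ext_iff_of_nodup]
    · intro a
      simp only [List.mem_filter, List.mem_finRange, true_and, List.mem_map]
      constructor
      · intro ha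
        exact ⟨_, ha, by simp⟩
      · rintro ⟨b, hb, rfl⟩
        simpa using hb
    · exact (List.nodup_finRange n).filter _
    · exact ((List.nodup_finRange n).filter _).map σ.injective

/-- colour sequence of a shuffle -/
def col (p q : ℕ) (σ : Equiv.Perm (Fin (p + q))) : List Bool :=
  List.ofFn fun i => decide (p ≤ (σ.symm i : ℕ))

lemma ofFn_col (p q : ℕ) : (List.ofFn fun i : Fin (p + q) => decide (p ≤ (i : ℕ))) =
    List.replicate p false ++ List.replicate q true := by
  apply List.ext_getElem
  · simp
  · intro i h1 h2
    simp only [List.getElem_ofFn, List.getElem_append, List.length_replicate,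
      List.getElem_replicate]
    split_ifs with h <;> simp <;> omega

lemma shWord_eq {V : Type*} (u v : List V) (σ : Equiv.Perm (Fin (u.length + v.length)))
    (hσ : IsSh u.length v.length σ) :
    shWord u v σ = FreeMonoid.ofList (mergeW (col u.length v.length σ) u v) := by
  set g : Fin (u.length + v.length) → V × Bool := fun j =>
    ((u ++ v).get (Fin.cast (List.length_append (as := u) (bs := v)).symm j),
      decide (u.length ≤ (j : ℕ))) with hg
  have hgl : (List.finRange _).map g = u.map (fun a => (a, false)) ++ v.map (fun a => (a, true)) := by
    apply List.ext_getElem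
    · simp
    · intro i h1 h2
      simp only [List.getElem_map, List.getElem_finRange, List.getElem_append, hg, List.length_map]
      split_ifs with h <;> simp [List.getElem_append, h] <;> omega
  have key := mergeW_filter ((List.finRange (u.length + v.length)).map (fun i => g (σ.symm i)))
  have hf : ∀ Q : Bool → Bool, (∀ i j : Fin (u.length + v.length),
        Q (decide (u.length ≤ (i : ℕ))) → Q (decide (u.length ≤ (j : ℕ))) → i < j → σ i < σ j) →
      ((List.finRange (u.length + v.length)).map (fun i => g (σ.symm i))).filter (fun a => Q a.2)
        = (u.map (fun a => (a, false)) ++ v.map (fun a => (a, true))).filter (fun a => Q a.2) := by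
    intro Q hQ
    rw [← hgl, List.filter_map, List.filter_map]
    have := filter_sh σ (fun i => Q (g i).2) hQ
    simp only [Function.comp_def]
    rw [this, List.map_map]
    simp [Function.comp_def]
  rw [hf (fun b => !b), hf (fun b => b)] at key
  · simp only [List.filter_append, List.filter_map, Function.comp_def, List.map_append, List.map_map] at key
    simp only [shWord, col]
    congr 1
    simp [List.ofFn_eq_map]
    simpa [Function.comp_def, hg] using key.symm
  · intro i j hi hj hij
    exact hσ.2 i j (by simpa using hi) hij
  · intro i j hi hj hij
    exact hσ.1 i j hij (by simpa using hj)

lemma col_perm (p q : ℕ) (σ : Equiv.Perm (Fin (p + q))) : col p q σ ∈ C p q := by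
  simp only [C, List.mem_toFinset, List.mem_permutations, col, ← ofFn_col]
  exact Equiv.Perm.ofFn_comp_perm σ.symm (fun i : Fin (p + q) => decide (p ≤ (i : ℕ)))

lemma isSh_eq_sort (p q : ℕ) (σ : Equiv.Perm (Fin (p + q))) (h : IsSh p q σ) :
    σ = Tuple.sort (fun i => decide (p ≤ (σ.symm i : ℕ))) := by
  rw [Tuple.eq_sort_iff]
  constructor
  · intro i j hij
    simp only [Function.comp, Equiv.symm_apply_apply]
    rw [Bool.le_iff_imp]
    simp only [decide_eq_true_eq]
    intro hh
    exact hh.trans hij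
  · intro i j hij hc
    simp only [Equiv.symm_apply_apply, decide_eq_decide] at hc
    by_cases hi : p ≤ (i : ℕ)
    · exact h.2 i j hi hij
    · exact h.1 i j hij (by have := mt hc.2 hi; omega)

lemma col_inj (p q : ℕ) (σ τ : Equiv.Perm (Fin (p + q))) (h : IsSh p q σ) (h' : IsSh p q τ)
    (e : col p q σ = col p q τ) : σ = τ := by
  rw [isSh_eq_sort p q σ h, isSh_eq_sort p q τ h']
  congr 1
  exact List.ofFn_injective e

lemma col_surj (p q : ℕ) (c : List Bool) (hc : c ∈ C p q) :
    ∃ σ, IsSh p q σ ∧ col p q σ = c := by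
  have hperm : c.Perm (List.replicate p false ++ List.replicate q true) := by
    simpa [C] using hc
  have hl : c.length = p + q := by simpa using hperm.length_eq
  obtain ⟨f, rfl⟩ : ∃ f : Fin (p + q) → Bool, c = List.ofFn f :=
    ⟨fun i => c.get (Fin.cast hl.symm i), by apply List.ext_getElem <;> simp [hl]⟩
  set σ := Tuple.sort f with hσ
  have h1 := (Tuple.eq_sort_iff (f := f) (σ := σ)).1 hσ
  have h2 : List.ofFn (f ∘ σ) = List.ofFn fun i : Fin (p + q) => decide (p ≤ (i : ℕ)) := by
    refine List.Perm.eq_of_pairwise (le := (· ≤ ·)) ?_ ?_ ?_ ?_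
    · intro a b _ _ h1 h2
      exact le_antisymm h1 h2
    · rw [List.pairwise_ofFn]
      intro i j hij
      exact h1.1 hij.le
    · rw [List.pairwise_ofFn]
      intro i j hij
      rw [Bool.le_iff_imp]
      simp only [decide_eq_true_eq]
      intro hh
      have : (i : ℕ) < j := hij
      omega
    · rw [ofFn_col]
      exact (Equiv.Perm.ofFn_comp_perm σ f).trans hperm
  have h3 : ∀ i, f (σ i) = decide (p ≤ (i : ℕ)) := fun i => congrFun (List.ofFn_injective h2) i
  refine ⟨σ, ⟨?_, ?_⟩, ?_⟩
  · intro i j hij hj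
    apply h1.2 i j hij
    rw [h3, h3, decide_eq_decide]; omega
  · intro i j hi hij
    apply h1.2 i j hij
    rw [h3, h3, decide_eq_decide]; omega
  · unfold col
    congr 1
    funext i
    rw [← h3]; simp

lemma posCond_iff (p : ℕ) (b : Bool) (i : ℕ) : posCond p b i ↔ decide (p ≤ i) = b := by
  cases b <;> simp [posCond]

variable (k : Type*) [CommRing k] {V : Type*}

/-- endpoint condition -/
def ends (c : List Bool) (fb lb : Bool) : Prop := c.head? = some fb ∧ c.reverse.head? = some lb

instance (c : List Bool) (fb lb : Bool) : Decidable (ends c fb lb) := by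
  unfold ends; infer_instance

lemma ends_col (p q : ℕ) (fb lb : Bool) (σ : Equiv.Perm (Fin (p + q))) :
    (∃ h : 0 < p + q, posCond p fb (σ.symm ⟨0, h⟩) ∧
        posCond p lb (σ.symm ⟨p + q - 1, Nat.sub_lt h Nat.one_pos⟩)) ↔
      ends (col p q σ) fb lb := by
  simp only [posCond_iff, ends, List.head?_reverse, List.head?_eq_getElem?,
    List.getLast?_eq_getElem?, col, List.getElem?_ofFn, List.length_ofFn]
  by_cases h : 0 < p + q
  · have : p + q - 1 < p + q := by omega
    simp [h, this]
  · simp [h]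

lemma quadOp_eq (fb lb : Bool) (u v : List V) :
    quadOp k fb lb u v = ∑ c ∈ C u.length v.length,
      if ends c fb lb then MonoidAlgebra.single (FreeMonoid.ofList (mergeW c u v)) (1 : k) else 0 := by
  rw [← Finset.sum_filter]
  unfold quadOp
  refine Finset.sum_bij (fun σ _ => col u.length v.length σ) ?_ ?_ ?_ ?_
  · intro σ hσ
    simp only [Finset.mem_filter, Finset.mem_univ, true_and, ends_col] at hσ ⊢
    exact ⟨col_perm _ _ _, hσ.2⟩
  · intro σ hσ τ hτ e
    simp only [Finset.mem_filter, Finset.mem_univ, true_and] at hσ hτ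
    exact col_inj _ _ _ _ hσ.1 hτ.1 e
  · intro c hc
    simp only [Finset.mem_filter] at hc
    obtain ⟨σ, h1, rfl⟩ := col_surj _ _ _ hc.1
    refine ⟨σ, ?_, rfl⟩
    simp only [Finset.mem_filter, Finset.mem_univ, true_and, ends_col]
    exact ⟨h1, hc.2⟩
  · intro σ hσ
    simp only [Finset.mem_filter, Finset.mem_univ, true_and] at hσ
    rw [shWord_eq _ _ _ hσ.1]

/-- three-fold merge -/
def mergeT : List (Fin 3) → List V → List V → List V → List V
  | 0 :: d, a :: x, y, z => a :: mergeT d x y z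
  | 1 :: d, x, a :: y, z => a :: mergeT d x y z
  | 2 :: d, x, y, a :: z => a :: mergeT d x y z
  | _, _, _, _ => []

def l1 : Fin 3 → Option Bool := ![some false, some true, none]
def l2 : Fin 3 → Bool := ![false, false, true]
def r1 : Fin 3 → Option Bool := ![none, some false, some true]
def r2 : Fin 3 → Bool := ![false, true, true]

lemma l10 : l1 0 = some false := rfl
lemma l11 : l1 1 = some true := rfl
lemma l12 (d : List (Fin 3)) : (2 :: d).filterMap l1 = d.filterMap l1 := rfl
lemma l20 : l2 0 = false := rfl
lemma l21 : l2 1 = false := rfl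
lemma l22 : l2 2 = true := rfl
lemma r10 (d : List (Fin 3)) : (0 :: d).filterMap r1 = d.filterMap r1 := rfl
lemma r11 : r1 1 = some false := rfl
lemma r12 : r1 2 = some true := rfl
lemma r20 : r2 0 = false := rfl
lemma r21 : r2 1 = true := rfl
lemma r22 : r2 2 = true := rfl

lemma fin3 (a : Fin 3) : a = 0 ∨ a = 1 ∨ a = 2 := by
  fin_cases a <;> simp

lemma mergeT_left (d : List (Fin 3)) : ∀ (x y z : List V), d.count 0 = x.length →
    d.count 1 = y.length → d.count 2 = z.length →
    mergeW (d.map l2) (mergeW (d.filterMap l1) x y) z = mergeT d x y z := by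
  induction d with
  | nil => intros; simp [mergeW, mergeT]
  | cons a d ih =>
    intro x y z h0 h1 h2
    rcases fin3 a with rfl | rfl | rfl
    · cases x with
      | nil => simp at h0
      | cons b x =>
        simp [l10, l20, mergeW, mergeT] at *
        exact ih x y z h0 h1 h2
    · cases y with
      | nil => simp at h1
      | cons b y =>
        simp [l11, l21, mergeW, mergeT] at *
        exact ih x y z h0 h1 h2
    · cases z with
      | nil => simp at h2
      | cons b z =>
        simp [l12, l22, mergeW, mergeT] at *
        exact ih x y z h0 h1 h2

lemma mergeT_right (d : List (Fin 3)) : ∀ (x y z : List V), d.count 0 = x.length →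
    d.count 1 = y.length → d.count 2 = z.length →
    mergeW (d.map r2) x (mergeW (d.filterMap r1) y z) = mergeT d x y z := by
  induction d with
  | nil => intros; simp [mergeW, mergeT]
  | cons a d ih =>
    intro x y z h0 h1 h2
    rcases fin3 a with rfl | rfl | rfl
    · cases x with
      | nil => simp at h0
      | cons b x =>
        simp [r10, r20, mergeW, mergeT] at *
        exact ih x y z h0 h1 h2
    · cases y with
      | nil => simp at h1
      | cons b y =>
        simp [r11, r21, mergeW, mergeT] at *
        exact ih x y z h0 h1 h2
    · cases z with
      | nil => simp at h2
      | cons b z =>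
        simp [r12, r22, mergeW, mergeT] at *
        exact ih x y z h0 h1 h2

lemma counts (d : List (Fin 3)) :
    (d.filterMap l1).count false = d.count 0 ∧ (d.filterMap l1).count true = d.count 1 ∧
    (d.map l2).count false = d.count 0 + d.count 1 ∧ (d.map l2).count true = d.count 2 ∧
    (d.filterMap r1).count false = d.count 1 ∧ (d.filterMap r1).count true = d.count 2 ∧
    (d.map r2).count false = d.count 0 ∧ (d.map r2).count true = d.count 1 + d.count 2 := by
  induction d with
  | nil => simp
  | cons a d ih =>
    rcases fin3 a with rfl | rfl | rfl <;>
    simp [l10, l11, l12, l20, l21, l22, r10, r11, r12, r20, r21, r22, ih] <;> omega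

/-- inverse on the left -/
def combL : List Bool → List Bool → List (Fin 3)
  | c1, true :: c2 => 2 :: combL c1 c2
  | b :: c1, false :: c2 => (if b then 1 else 0) :: combL c1 c2
  | _, _ => []

/-- inverse on the right -/
def combR : List Bool → List Bool → List (Fin 3)
  | c1, false :: c2 => 0 :: combR c1 c2
  | b :: c1, true :: c2 => (if b then 2 else 1) :: combR c1 c2
  | _, _ => []

lemma combL_spec (c2 : List Bool) : ∀ c1 : List Bool, c2.count false = c1.length →
    (combL c1 c2).filterMap l1 = c1 ∧ (combL c1 c2).map l2 = c2 := by
  induction c2 with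
  | nil => intro c1 h; simp at h; obtain rfl := List.length_eq_zero_iff.1 h.symm; simp [combL]
  | cons a c2 ih =>
    intro c1 h
    cases a
    · cases c1 with
      | nil => simp at h
      | cons b c1 =>
        have := ih c1 (by simpa using h)
        cases b <;> simp [combL, l10, l11, l20, l21, this]
    · have := ih c1 (by simpa using h)
      simp [combL, l12, l22, this]

lemma combR_spec (c2 : List Bool) : ∀ c1 : List Bool, c2.count true = c1.length →
    (combR c1 c2).filterMap r1 = c1 ∧ (combR c1 c2).map r2 = c2 := by
  induction c2 with
  | nil => intro c1 h; simp at h; obtain rfl := List.length_eq_zero_iff.1 h.symm; simp [combR]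
  | cons a c2 ih =>
    intro c1 h
    cases a
    · have := ih c1 (by simpa using h)
      simp [combR, r10, r20, this]
    · cases c1 with
      | nil => simp at h
      | cons b c1 =>
        have := ih c1 (by simpa using h)
        cases b <;> simp [combR, r11, r12, r21, r22, this]

lemma combL_inv (d : List (Fin 3)) : combL (d.filterMap l1) (d.map l2) = d := by
  induction d with
  | nil => simp [combL]
  | cons a d ih =>
    rcases fin3 a with rfl | rfl | rfl <;> simp [l10, l11, l12, l20, l21, l22, combL, ih]

lemma combR_inv (d : List (Fin 3)) : combR (d.filterMap r1) (d.map r2) = d := by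
  induction d with
  | nil => simp [combR]
  | cons a d ih =>
    rcases fin3 a with rfl | rfl | rfl <;> simp [r10, r11, r12, r20, r21, r22, combR, ih]

lemma len_count (c : List Bool) : c.length = c.count false + c.count true := by
  have := List.count_false_add_count_true c
  omega

lemma sumL {M : Type*} [AddCommMonoid M] (p q r : ℕ) (F : List Bool → List Bool → M) :
    ∑ c1 ∈ C p q, ∑ c2 ∈ C (p + q) r, F c1 c2 =
      ∑ d ∈ D p q r, F (d.filterMap l1) (d.map l2) := by
  rw [← Finset.sum_product']
  symm
  refine Finset.sum_bij' (fun d _ => (d.filterMap l1, d.map l2)) (fun c _ => combL c.1 c.2)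
    ?_ ?_ ?_ ?_ ?_
  · intro d hd
    have := counts d
    simp only [Finset.mem_product, mem_C, mem_D] at *
    omega
  · intro c hc
    simp only [Finset.mem_product, mem_C, mem_D] at *
    have h := combL_spec c.2 c.1 (by rw [len_count]; omega)
    have := counts (combL c.1 c.2)
    rw [h.1, h.2] at this
    omega
  · intro d _
    exact combL_inv d
  · intro c hc
    simp only [Finset.mem_product, mem_C] at *
    have h := combL_spec c.2 c.1 (by rw [len_count]; omega)
    exact Prod.ext h.1 h.2
  · intro d _
    rfl

lemma sumR {M : Type*} [AddCommMonoid M] (p q r : ℕ) (F : List Bool → List Bool → M) :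
    ∑ c1 ∈ C q r, ∑ c2 ∈ C p (q + r), F c1 c2 =
      ∑ d ∈ D p q r, F (d.filterMap r1) (d.map r2) := by
  rw [← Finset.sum_product']
  symm
  refine Finset.sum_bij' (fun d _ => (d.filterMap r1, d.map r2)) (fun c _ => combR c.1 c.2)
    ?_ ?_ ?_ ?_ ?_
  · intro d hd
    have := counts d
    simp only [Finset.mem_product, mem_C, mem_D] at *
    omega
  · intro c hc
    simp only [Finset.mem_product, mem_C, mem_D] at *
    have h := combR_spec c.2 c.1 (by rw [len_count]; omega)
    have := counts (combR c.1 c.2)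
    rw [h.1, h.2] at this
    omega
  · intro d _
    exact combR_inv d
  · intro c hc
    simp only [Finset.mem_product, mem_C] at *
    have h := combR_spec c.2 c.1 (by rw [len_count]; omega)
    exact Prod.ext h.1 h.2
  · intro d _
    rfl

lemma mergeW_length (c : List Bool) : ∀ u v : List V, c ∈ C u.length v.length →
    (mergeW c u v).length = u.length + v.length := by
  induction c with
  | nil => intro u v h; simp [mem_C] at h; simp [mergeW]; omega
  | cons a c ih =>
    intro u v h
    simp only [mem_C] at *
    cases a
    · cases u with
      | nil => simp at h
      | cons b u =>
        simp [mergeW] at *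
        rw [ih u v h.1 h.2]; omega
    · cases v with
      | nil => simp at h
      | cons b v =>
        simp [mergeW] at *
        rw [ih u v h.1 h.2]; omega

variable (f : FreeMonoid V → FreeMonoid V → MonoidAlgebra k (FreeMonoid V))

lemma liftB_add_left (x x' y : MonoidAlgebra k (FreeMonoid V)) :
    liftB k f (x + x') y = liftB k f x y + liftB k f x' y := by
  unfold liftB
  rw [MonoidAlgebra.coeff_add, Finsupp.sum_add_index']
  · intro a; simp
  · intro a b c; simp [add_mul, add_smul, Finsupp.sum_add]

lemma liftB_add_right (x y y' : MonoidAlgebra k (FreeMonoid V)) :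
    liftB k f x (y + y') = liftB k f x y + liftB k f x y' := by
  unfold liftB
  rw [← Finsupp.sum_add]
  congr 1
  funext a c
  rw [MonoidAlgebra.coeff_add, Finsupp.sum_add_index']
  · intro a; simp
  · intro a b c; simp [mul_add, add_smul]

lemma liftB_sum_left {ι : Type*} (s : Finset ι) (g : ι → MonoidAlgebra k (FreeMonoid V))
    (y : MonoidAlgebra k (FreeMonoid V)) :
    liftB k f (∑ i ∈ s, g i) y = ∑ i ∈ s, liftB k f (g i) y :=
  map_sum (AddMonoidHom.mk' (fun x => liftB k f x y) (fun a b => liftB_add_left k f a b y)) g s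

lemma liftB_sum_right {ι : Type*} (s : Finset ι) (g : ι → MonoidAlgebra k (FreeMonoid V))
    (x : MonoidAlgebra k (FreeMonoid V)) :
    liftB k f x (∑ i ∈ s, g i) = ∑ i ∈ s, liftB k f x (g i) :=
  map_sum (AddMonoidHom.mk' (fun y => liftB k f x y) (fun a b => liftB_add_right k f x a b)) g s

lemma liftB_zero_left (y : MonoidAlgebra k (FreeMonoid V)) : liftB k f 0 y = 0 := by
  simp [liftB]

lemma liftB_zero_right (y : MonoidAlgebra k (FreeMonoid V)) : liftB k f y 0 = 0 := by
  simp [liftB]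

lemma liftB_single (a b : FreeMonoid V) :
    liftB k f (MonoidAlgebra.single a 1) (MonoidAlgebra.single b 1) = f a b := by
  simp [liftB, MonoidAlgebra.coeff_single]

/-- bilinear extension of the generic operation -/
noncomputable def qH (fb lb : Bool) : MonoidAlgebra k (FreeMonoid V) → MonoidAlgebra k (FreeMonoid V) →
    MonoidAlgebra k (FreeMonoid V) :=
  liftB k fun a b => quadOp k fb lb (FreeMonoid.toList a) (FreeMonoid.toList b)

lemma qH_left (fb lb fb' lb' : Bool) (x y z : List V) :
    qH k fb lb (quadOp k fb' lb' x y) (wordElt k z) =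
      ∑ d ∈ D x.length y.length z.length,
        if ends (d.filterMap l1) fb' lb' ∧ ends (d.map l2) fb lb then
          MonoidAlgebra.single (FreeMonoid.ofList (mergeT d x y z)) (1 : k) else 0 := by
  rw [quadOp_eq, qH, liftB_sum_left]
  have : ∀ c1 ∈ C x.length y.length,
      liftB k (fun a b => quadOp k fb lb (FreeMonoid.toList a) (FreeMonoid.toList b))
        (if ends c1 fb' lb' then
          MonoidAlgebra.single (FreeMonoid.ofList (mergeW c1 x y)) (1 : k) else 0) (wordElt k z) =
      ∑ c2 ∈ C (x.length + y.length) z.length, if ends c1 fb' lb' ∧ ends c2 fb lb then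
        MonoidAlgebra.single (FreeMonoid.ofList (mergeW c2 (mergeW c1 x y) z)) (1 : k) else 0 := by
    intro c1 h1
    by_cases h : ends c1 fb' lb'
    · simp only [h, if_true, true_and, wordElt, liftB_single, FreeMonoid.toList_ofList]
      rw [quadOp_eq, mergeW_length _ _ _ h1]
    · simp [h, liftB_zero_left]
  rw [Finset.sum_congr rfl this, sumL _ _ _ (fun c1 c2 => if ends c1 fb' lb' ∧ ends c2 fb lb then
        MonoidAlgebra.single (FreeMonoid.ofList (mergeW c2 (mergeW c1 x y) z)) (1 : k) else 0)]
  refine Finset.sum_congr rfl fun d hd => ?_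
  rw [mem_D] at hd
  rw [mergeT_left d x y z hd.1 hd.2.1 hd.2.2]

lemma qH_right (fb lb fb' lb' : Bool) (x y z : List V) :
    qH k fb lb (wordElt k x) (quadOp k fb' lb' y z) =
      ∑ d ∈ D x.length y.length z.length,
        if ends (d.filterMap r1) fb' lb' ∧ ends (d.map r2) fb lb then
          MonoidAlgebra.single (FreeMonoid.ofList (mergeT d x y z)) (1 : k) else 0 := by
  rw [quadOp_eq, qH, liftB_sum_right]
  have : ∀ c1 ∈ C y.length z.length,
      liftB k (fun a b => quadOp k fb lb (FreeMonoid.toList a) (FreeMonoid.toList b))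
        (wordElt k x) (if ends c1 fb' lb' then
          MonoidAlgebra.single (FreeMonoid.ofList (mergeW c1 y z)) (1 : k) else 0) =
      ∑ c2 ∈ C x.length (y.length + z.length), if ends c1 fb' lb' ∧ ends c2 fb lb then
        MonoidAlgebra.single (FreeMonoid.ofList (mergeW c2 x (mergeW c1 y z))) (1 : k) else 0 := by
    intro c1 h1
    by_cases h : ends c1 fb' lb'
    · simp only [h, if_true, true_and, wordElt, liftB_single, FreeMonoid.toList_ofList]
      rw [quadOp_eq, mergeW_length _ _ _ h1]
    · simp [h, liftB_zero_right]
  rw [Finset.sum_congr rfl this, sumR _ _ _ (fun c1 c2 => if ends c1 fb' lb' ∧ ends c2 fb lb then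
        MonoidAlgebra.single (FreeMonoid.ofList (mergeW c2 x (mergeW c1 y z))) (1 : k) else 0)]
  refine Finset.sum_congr rfl fun d hd => ?_
  rw [mem_D] at hd
  rw [mergeT_right d x y z hd.1 hd.2.1 hd.2.2]

/-- possible colours of the first letter in the four projections -/
def heads (d : List (Fin 3)) (a b c e : Bool) : Prop :=
  (d.filterMap l1).head? = some a ∧ (d.map l2).head? = some b ∧
  (d.filterMap r1).head? = some c ∧ (d.map r2).head? = some e

lemma head_ex (c : List Bool) (h : 0 < c.count false) : c.head? = some false ∨ c.head? = some true := by
  cases c with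
  | nil => simp at h
  | cons a c => cases a <;> simp

lemma heads_cases (d : List (Fin 3)) (h0 : 0 < d.count 0) (h1 : 0 < d.count 1) :
    heads d false false false false ∨ heads d false false true false ∨
    heads d true false false true ∨ heads d false true true true ∨ heads d true true true true := by
  have hc := counts d
  have e1 := head_ex (d.filterMap l1) (by omega)
  have e2 := head_ex (d.filterMap r1) (by omega)
  unfold heads
  cases d with
  | nil => simp at h0
  | cons a d =>
    rcases fin3 a with rfl | rfl | rfl <;>
    simp [l10, l11, l12, l20, l21, l22, r10, r11, r12, r20, r21, r22] at e1 e2 ⊢ <;> tauto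

lemma heads_rev (d : List (Fin 3)) (a b c e : Bool) (h : heads d.reverse a b c e) :
    (d.filterMap l1).reverse.head? = some a ∧ (d.map l2).reverse.head? = some b ∧
    (d.filterMap r1).reverse.head? = some c ∧ (d.map r2).reverse.head? = some e := by
  simpa only [heads, List.filterMap_reverse, List.map_reverse] using h

end QA

/-- the nine Aguiar–Loday quadri-algebra axioms. -/
theorem statement14 (x y z : List V) (hx : x ≠ []) (hy : y ≠ []) (hz : z ≠ []) :
    nwH k (nwOp k x y) (wordElt k z) = nwH k (wordElt k x) (starOp k y z) ∧
    nwH k (neOp k x y) (wordElt k z) = neH k (wordElt k x) (precOp k y z) ∧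
    neH k (wedgeOp k x y) (wordElt k z) = neH k (wordElt k x) (succOp k y z) ∧
    nwH k (swOp k x y) (wordElt k z) = swH k (wordElt k x) (wedgeOp k y z) ∧
    nwH k (seOp k x y) (wordElt k z) = seH k (wordElt k x) (nwOp k y z) ∧
    neH k (veeOp k x y) (wordElt k z) = seH k (wordElt k x) (neOp k y z) ∧
    swH k (precOp k x y) (wordElt k z) = swH k (wordElt k x) (veeOp k y z) ∧
    swH k (succOp k x y) (wordElt k z) = seH k (wordElt k x) (swOp k y z) ∧
    seH k (starOp k x y) (wordElt k z) = seH k (wordElt k x) (seOp k y z) := by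
  have e1 : @seH k _ V = QA.qH k true true := rfl
  have e2 : @neH k _ V = QA.qH k true false := rfl
  have e3 : @nwH k _ V = QA.qH k false false := rfl
  have e4 : @swH k _ V = QA.qH k false true := rfl
  have al : ∀ a b (u u' v : MonoidAlgebra k (FreeMonoid V)),
      QA.qH k a b (u + u') v = QA.qH k a b u v + QA.qH k a b u' v :=
    fun a b u u' v => QA.liftB_add_left k _ u u' v
  have ar : ∀ a b (u v v' : MonoidAlgebra k (FreeMonoid V)),
      QA.qH k a b u (v + v') = QA.qH k a b u v + QA.qH k a b u v' :=
    fun a b u v v' => QA.liftB_add_right k _ u v v'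
  simp only [e1, e2, e3, e4, starOp, precOp, succOp, wedgeOp, veeOp, seOp, neOp, nwOp, swOp,
    al, ar, QA.qH_left, QA.qH_right, ← Finset.sum_add_distrib]
  have hx' := List.length_pos_iff.2 hx
  have hy' := List.length_pos_iff.2 hy
  refine ⟨?_, ?_, ?_, ?_, ?_, ?_, ?_, ?_, ?_⟩ <;>
  · refine Finset.sum_congr rfl fun d hd => ?_
    rw [QA.mem_D] at hd
    generalize MonoidAlgebra.single (FreeMonoid.ofList (QA.mergeT d x y z)) (1 : k) = m
    have H := QA.heads_cases d (by omega) (by omega)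
    have H' := QA.heads_cases d.reverse (by rw [List.count_reverse]; omega)
      (by rw [List.count_reverse]; omega)
    unfold QA.ends
    rcases H with H | H | H | H | H <;> rcases H' with H' | H' | H' | H' | H' <;>
    · have H' := QA.heads_rev _ _ _ _ _ H'
      obtain ⟨h1, h2, h3, h4⟩ := H
      obtain ⟨g1, g2, g3, g4⟩ := H'
      simp [h1, h2, h3, h4, g1, g2, g3, g4, -List.head?_reverse]
end

section
/- For all nonempty words x, y, z over V, the operations ≺ and ≻ satisfy the dendriform axioms (the horizontal dendriform structure): (x≺y)≺z = x≺(y⧢z), (x≻y)≺z = x≻(y≺z), and (x⧢y)≻z = x≻(y≻z). -/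
open Finset MonoidAlgebra TensorProduct

variable (k : Type*) [CommRing k] {V : Type*}

namespace QS

def ShN (N p : ℕ) (σ : Equiv.Perm (Fin N)) : Prop :=
  (∀ i j : Fin N, (i : ℕ) < (j : ℕ) → (j : ℕ) < p → σ i < σ j) ∧
  (∀ i j : Fin N, p ≤ (i : ℕ) → (i : ℕ) < (j : ℕ) → σ i < σ j)

/-- insert `j ↦ 0`. -/
def ins {n : ℕ} (j : Fin (n + 1)) (τ : Equiv.Perm (Fin n)) : Equiv.Perm (Fin (n + 1)) :=
  ((finSuccEquiv' j).trans (Equiv.optionCongr τ)).trans (finSuccEquiv' 0).symm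

lemma ins_self {n : ℕ} (j : Fin (n + 1)) (τ : Equiv.Perm (Fin n)) : ins j τ j = 0 := by
  simp [ins]

lemma ins_succAbove {n : ℕ} (j : Fin (n + 1)) (τ : Equiv.Perm (Fin n)) (i : Fin n) :
    ins j τ (j.succAbove i) = (τ i).succ := by
  simp [ins]

lemma ins_symm_zero {n : ℕ} (j : Fin (n + 1)) (τ : Equiv.Perm (Fin n)) :
    (ins j τ).symm 0 = j := by
  rw [Equiv.symm_apply_eq, ins_self]

lemma ins_symm_succ {n : ℕ} (j : Fin (n + 1)) (τ : Equiv.Perm (Fin n)) (i : Fin n) :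
    (ins j τ).symm i.succ = j.succAbove (τ.symm i) := by
  rw [Equiv.symm_apply_eq, ins_succAbove]; simp

lemma ins_inj {n : ℕ} (j : Fin (n + 1)) : Function.Injective (ins j) := by
  intro τ τ' h
  ext i
  have := congrArg (fun e => e (j.succAbove i)) h
  simp only [ins_succAbove] at this
  simpa using congrArg Fin.val this

lemma ins_surj {n : ℕ} (j : Fin (n + 1)) (σ : Equiv.Perm (Fin (n + 1))) (h : σ.symm 0 = j) :
    ∃ τ, ins j τ = σ := by
  let e := ((finSuccEquiv' j).symm.trans σ).trans (finSuccEquiv' 0)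
  have he : e none = none := by
    simp [e, ← h]
  have he' : Equiv.optionCongr (Equiv.removeNone e) = e := by
    ext1 x
    cases x with
    | none => simp [he]
    | some x => 
      rw [Equiv.optionCongr_apply, Option.map_some]
      apply Equiv.removeNone_some
      apply Option.ne_none_iff_exists'.1
      intro hn
      have := e.injective (hn.trans he.symm)
      simp at this
  refine ⟨Equiv.removeNone e, ?_⟩
  unfold ins
  rw [he']
  ext x
  simp [e]

open Classical in
noncomputable def S (N p : ℕ) (w : Fin N → V) : MonoidAlgebra k (FreeMonoid V) :=
  ∑ σ ∈ univ.filter (ShN N p), MonoidAlgebra.single (FreeMonoid.ofList (List.ofFn (w ∘ σ.symm))) (1 : k)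

open Classical in
noncomputable def B (N p : ℕ) (fb : Bool) (w : Fin N → V) : MonoidAlgebra k (FreeMonoid V) :=
  ∑ σ ∈ univ.filter (fun σ : Equiv.Perm (Fin N) => ShN N p σ ∧
      ∃ h : 0 < N, posCond p fb (σ.symm ⟨0, h⟩)),
    MonoidAlgebra.single (FreeMonoid.ofList (List.ofFn (w ∘ σ.symm))) (1 : k)

noncomputable def lt (a : V) : MonoidAlgebra k (FreeMonoid V) :=
  MonoidAlgebra.single (FreeMonoid.of a) (1 : k)

lemma B_succ (n p p' : ℕ) (fb : Bool) (w : Fin (n + 1) → V) (j : Fin (n + 1))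
    (h1 : ∀ τ, ShN (n + 1) p (ins j τ) ↔ ShN n p' τ)
    (h2 : ∀ σ, ShN (n + 1) p σ → (posCond p fb (σ.symm 0) ↔ σ.symm 0 = j)) :
    B k (n + 1) p fb w = lt k (w j) * S k n p' (w ∘ j.succAbove) := by
  classical
  unfold B S lt
  rw [Finset.mul_sum]
  symm
  refine Finset.sum_bij (fun τ _ => ins j τ) ?_ ?_ ?_ ?_
  · intro τ hτ
    simp only [mem_filter, mem_univ, true_and] at hτ ⊢
    have := (h1 τ).2 hτ
    exact ⟨this, Nat.succ_pos _, (h2 _ this).2 (ins_symm_zero j τ)⟩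
  · intro _ _ _ _ h
    exact ins_inj j h
  · intro σ hσ
    simp only [mem_filter, mem_univ, true_and] at hσ
    obtain ⟨hs, _, hp⟩ := hσ
    obtain ⟨τ, rfl⟩ := ins_surj j σ ((h2 σ hs).1 hp)
    exact ⟨τ, by simpa using (h1 τ).1 hs, rfl⟩
  · intro τ _
    rw [MonoidAlgebra.single_mul_single, one_mul]
    congr 1
    rw [List.ofFn_succ]
    simp only [Function.comp_apply, ins_symm_zero, ins_symm_succ]
    rfl

lemma sh_first_lt {n p : ℕ} (σ : Equiv.Perm (Fin (n + 1))) (h : ShN (n + 1) (p + 1) σ) :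
    posCond (p + 1) false (σ.symm 0) ↔ σ.symm 0 = 0 := by
  constructor
  · intro hp
    by_contra hne
    have := h.1 0 (σ.symm 0) (by have := Fin.pos_iff_ne_zero.2 hne; exact this) hp
    simp at this
  · intro h0
    rw [h0]; exact Nat.succ_pos _

lemma sh_first_ge {n p : ℕ} (hp : p < n + 1) (σ : Equiv.Perm (Fin (n + 1)))
    (h : ShN (n + 1) p σ) :
    posCond p true (σ.symm 0) ↔ σ.symm 0 = ⟨p, hp⟩ := by
  constructor
  · intro hp'
    by_contra hne
    have hp'' : p ≤ (σ.symm 0 : ℕ) := hp'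
    have := h.2 ⟨p, hp⟩ (σ.symm 0) le_rfl (by
      rcases hp''.lt_or_eq with h | h
      · exact h
      · exact absurd (Fin.ext h.symm) hne)
    simp at this
  · intro h0
    rw [h0]; exact le_rfl

lemma ins_sh_zero {n p : ℕ} (τ : Equiv.Perm (Fin n)) :
    ShN (n + 1) (p + 1) (ins 0 τ) ↔ ShN n p τ := by
  have hs : ∀ i : Fin n, ins 0 τ i.succ = (τ i).succ := fun i => by
    simpa using ins_succAbove 0 τ i
  constructor
  · rintro ⟨h1, h2⟩
    refine ⟨fun i j hij hj => ?_, fun i j hi hij => ?_⟩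
    · simpa [hs] using h1 i.succ j.succ (by simpa using hij) (by simpa using hj)
    · simpa [hs] using h2 i.succ j.succ (by simpa using hi) (by simpa using hij)
  · rintro ⟨h1, h2⟩
    refine ⟨fun i j hij hj => ?_, fun i j hi hij => ?_⟩
    · induction j using Fin.cases with
      | zero => simp at hij
      | succ j =>
        induction i using Fin.cases with
        | zero => rw [ins_self, hs]; exact Fin.succ_pos _
        | succ i => simpa [hs] using h1 i j (by simpa using hij) (by simpa using hj)
    · induction j using Fin.cases with
      | zero => simp at hij
      | succ j =>
        induction i using Fin.cases with
        | zero => simp at hi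
        | succ i => simpa [hs] using h2 i j (by simpa using hi) (by simpa using hij)

lemma succAbove_val {n : ℕ} (j : Fin (n + 1)) (i : Fin n) :
    (j.succAbove i : ℕ) = if (i : ℕ) < j then (i : ℕ) else i + 1 := by
  unfold Fin.succAbove
  simp only [Fin.lt_def, Fin.val_castSucc]
  split_ifs <;> simp

lemma ins_sh_mid {n p : ℕ} (hp : p < n + 1) (τ : Equiv.Perm (Fin n)) :
    ShN (n + 1) p (ins ⟨p, hp⟩ τ) ↔ ShN n p τ := by
  have hs := ins_succAbove ⟨p, hp⟩ τ
  have hv := succAbove_val (⟨p, hp⟩ : Fin (n + 1))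
  simp only at hv
  constructor
  · rintro ⟨h1, h2⟩
    refine ⟨fun i j hij hj => ?_, fun i j hi hij => ?_⟩
    · simpa [hs] using h1 (Fin.succAbove ⟨p, hp⟩ i) (Fin.succAbove ⟨p, hp⟩ j)
        (by rw [hv, hv]; split_ifs <;> omega) (by rw [hv]; split_ifs; omega)
    · simpa [hs] using h2 (Fin.succAbove ⟨p, hp⟩ i) (Fin.succAbove ⟨p, hp⟩ j)
        (by rw [hv]; split_ifs <;> omega) (by rw [hv, hv]; split_ifs <;> omega)
  · rintro ⟨h1, h2⟩
    refine ⟨fun i j hij hj => ?_, fun i j hi hij => ?_⟩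
    · rcases Fin.eq_self_or_eq_succAbove ⟨p, hp⟩ j with rfl | ⟨j, rfl⟩
      · simp at hj
      rcases Fin.eq_self_or_eq_succAbove ⟨p, hp⟩ i with rfl | ⟨i, rfl⟩
      · simp at hij; omega
      rw [hs, hs, Fin.succ_lt_succ_iff]
      rw [hv] at hj hij
      rw [hv] at hij
      apply h1 <;> (split_ifs at hj hij <;> omega)
    · rcases Fin.eq_self_or_eq_succAbove ⟨p, hp⟩ j with rfl | ⟨j, rfl⟩
      · simp at hij; omega
      rcases Fin.eq_self_or_eq_succAbove ⟨p, hp⟩ i with rfl | ⟨i, rfl⟩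
      · rw [ins_self, hs]; exact Fin.succ_pos _
      rw [hs, hs, Fin.succ_lt_succ_iff]
      rw [hv] at hi hij
      rw [hv] at hij
      apply h2 <;> (split_ifs at hi hij <;> omega)

lemma shuffleProd_eq (u v : List V) (N : ℕ) (h : u.length + v.length = N) :
    shuffleProd k u v = S k N u.length (fun i => (u ++ v)[(i : ℕ)]'(by simp [h])) := by
  subst h
  unfold shuffleProd S
  apply Finset.sum_congr
  · ext σ; simp [IsSh, ShN]
  · intro σ _; rfl

lemma quad_add (fb : Bool) (u v : List V) (N : ℕ) (h : u.length + v.length = N) :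
    quadOp k fb false u v + quadOp k fb true u v =
      B k N u.length fb (fun i => (u ++ v)[(i : ℕ)]'(by simp [h])) := by
  subst h
  classical
  unfold quadOp B
  rw [Finset.sum_filter, Finset.sum_filter, Finset.sum_filter, ← Finset.sum_add_distrib]
  apply Finset.sum_congr rfl
  intro σ _
  have e : single (FreeMonoid.ofList (List.ofFn ((fun i : Fin (u.length + v.length) =>
    (u ++ v)[(i : ℕ)]'(by simp)) ∘ σ.symm))) (1 : k) = single (shWord u v σ) 1 := rfl
  rw [e]
  have hI : IsSh u.length v.length σ ↔ ShN (u.length + v.length) u.length σ := Iff.rfl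
  by_cases h0 : 0 < u.length + v.length
  · simp only [hI, h0, exists_true_left, posCond]
    by_cases h1 : ((σ.symm ⟨u.length + v.length - 1, Nat.sub_lt h0 Nat.one_pos⟩ : Fin _) : ℕ) < u.length
    · simp [h1, not_le.2 h1]
    · simp [h1, not_lt.1 h1]
  · simp [h0]

lemma S_split (N p : ℕ) (hN : 0 < N) (w : Fin N → V) :
    S k N p w = B k N p false w + B k N p true w := by
  classical
  unfold S B
  rw [Finset.sum_filter, Finset.sum_filter, Finset.sum_filter, ← Finset.sum_add_distrib]
  apply Finset.sum_congr rfl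
  intro σ _
  simp only [hN, exists_true_left, posCond]
  by_cases h1 : ((σ.symm ⟨0, hN⟩ : Fin _) : ℕ) < p
  · simp [h1, not_le.2 h1]
  · simp [h1, not_lt.1 h1]

lemma prec_cons (a : V) (u v : List V) :
    precOp k (a :: u) v = lt k a * shuffleProd k u v := by
  have h : (a :: u).length + v.length = (u.length + v.length) + 1 := by simp; omega
  unfold precOp nwOp swOp
  rw [quad_add k false _ _ _ h, shuffleProd_eq k u v _ rfl]
  exact B_succ k _ (u.length + 1) u.length false _ 0 ins_sh_zero sh_first_lt

lemma succ_cons (b : V) (u v : List V) :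
    succOp k u (b :: v) = lt k b * shuffleProd k u v := by
  have h : u.length + (b :: v).length = (u.length + v.length) + 1 := by simp; omega
  unfold succOp neOp seOp
  have hp : u.length < u.length + v.length + 1 := by omega
  rw [quad_add k true _ _ _ h, shuffleProd_eq k u v _ rfl,
    B_succ k _ u.length u.length true _ ⟨u.length, hp⟩ (ins_sh_mid hp) (sh_first_ge hp)]
  congr 2
  · simp
  · funext i
    simp only [Function.comp_apply, succAbove_val]
    split_ifs with hi
    · rw [List.getElem_append_left hi, List.getElem_append_left hi]
    · rw [List.getElem_append_right (by omega), List.getElem_append_right (by omega)]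
      have : (i : ℕ) + 1 - u.length = (i - u.length) + 1 := by omega
      simp [this]

lemma prec_nil (v : List V) : precOp k [] v = 0 := by
  unfold precOp nwOp swOp
  rw [quad_add k false _ _ _ rfl]
  unfold B
  simp [posCond]

lemma succ_nil (u : List V) : succOp k u [] = 0 := by
  unfold succOp neOp seOp
  rw [quad_add k true _ _ _ rfl]
  unfold B
  apply Finset.sum_eq_zero
  intro σ hσ
  classical
  rw [mem_filter] at hσ
  obtain ⟨_, _, h, h'⟩ := hσ
  unfold posCond at h'
  have := (σ.symm ⟨0, h⟩).2
  simp at this h'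
  omega

lemma shuffle_split (u v : List V) (h : 0 < u.length + v.length) :
    shuffleProd k u v = precOp k u v + succOp k u v := by
  unfold precOp nwOp swOp succOp neOp seOp
  rw [quad_add k true _ _ _ rfl, quad_add k false _ _ _ rfl, shuffleProd_eq k u v _ rfl]
  exact S_split k _ _ h _

lemma shuffle_nil_nil : shuffleProd k ([] : List V) [] = wordElt k [] := by
  rw [shuffleProd_eq k _ _ 0 rfl]
  classical
  unfold S wordElt
  rw [Finset.filter_true_of_mem]
  · simp
  · intro σ _
    exact ⟨fun i => i.elim0, fun i => i.elim0⟩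

lemma lt_wordElt (a : V) (u : List V) : lt k a * wordElt k u = wordElt k (a :: u) := by
  unfold lt wordElt
  rw [MonoidAlgebra.single_mul_single, one_mul]; rfl

lemma shuffle_nil_left (v : List V) : shuffleProd k [] v = wordElt k v := by
  induction v with
  | nil => exact shuffle_nil_nil k
  | cons b v ih =>
    rw [shuffle_split k _ _ (by simp), prec_nil, succ_cons, ih, zero_add, lt_wordElt]

lemma shuffle_nil_right (v : List V) : shuffleProd k v [] = wordElt k v := by
  induction v with
  | nil => exact shuffle_nil_nil k
  | cons b v ih =>
    rw [shuffle_split k _ _ (by simp), succ_nil, prec_cons, ih, add_zero, lt_wordElt]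

section lift
variable (f g : FreeMonoid V → FreeMonoid V → MonoidAlgebra k (FreeMonoid V))

lemma liftB_zero_left (y) : liftB k f 0 y = 0 := by
  unfold liftB; simp

lemma liftB_zero_right (x) : liftB k f x 0 = 0 := by
  unfold liftB; simp

lemma liftB_add_left (x x' y) : liftB k f (x + x') y = liftB k f x y + liftB k f x' y := by
  unfold liftB
  rw [MonoidAlgebra.coeff_add, Finsupp.sum_add_index']
  · intro a; simp
  · intro a c c'
    simp only [add_mul, add_smul, Finsupp.sum_add]

lemma liftB_add_right (x y y') : liftB k f x (y + y') = liftB k f x y + liftB k f x y' := by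
  unfold liftB
  rw [MonoidAlgebra.coeff_add, ← Finsupp.sum_add]
  apply Finsupp.sum_congr
  intro a _
  rw [Finsupp.sum_add_index']
  · intro a; simp
  · intro a c c'
    simp only [mul_add, add_smul]

lemma liftB_single (a b : FreeMonoid V) (c d : k) :
    liftB k f (single a c) (single b d) = (c * d) • f a b := by
  unfold liftB
  rw [MonoidAlgebra.coeff_single, MonoidAlgebra.coeff_single, Finsupp.sum_single_index,
    Finsupp.sum_single_index] <;> simp

lemma liftB_fun_add (x y) :
    liftB k f x y + liftB k g x y = liftB k (fun a b => f a b + g a b) x y := by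
  unfold liftB
  simp only [smul_add, Finsupp.sum_add]
end lift

noncomputable def shH : MonoidAlgebra k (FreeMonoid V) → MonoidAlgebra k (FreeMonoid V) →
    MonoidAlgebra k (FreeMonoid V) :=
  liftB k fun a b => shuffleProd k (FreeMonoid.toList a) (FreeMonoid.toList b)

lemma precH_eq (x y : MonoidAlgebra k (FreeMonoid V)) : precH k x y =
    liftB k (fun a b => precOp k (FreeMonoid.toList a) (FreeMonoid.toList b)) x y :=
  liftB_fun_add k _ _ x y

lemma succH_eq (x y : MonoidAlgebra k (FreeMonoid V)) : succH k x y =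
    liftB k (fun a b => succOp k (FreeMonoid.toList a) (FreeMonoid.toList b)) x y :=
  liftB_fun_add k _ _ x y

lemma shH_word (u v : List V) : shH k (wordElt k u) (wordElt k v) = shuffleProd k u v := by
  unfold shH wordElt
  rw [liftB_single]; simp

lemma lt_single (a : V) (w : FreeMonoid V) (c : k) :
    lt k a * single w c = single (FreeMonoid.of a * w) c := by
  unfold lt
  rw [MonoidAlgebra.single_mul_single, one_mul]

lemma precH_lt (a : V) (x z : MonoidAlgebra k (FreeMonoid V)) :
    precH k (lt k a * x) z = lt k a * shH k x z := by
  rw [precH_eq]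
  unfold shH
  induction x using MonoidAlgebra.induction_linear with
  | zero => simp [liftB_zero_left]
  | add x y hx hy => rw [mul_add, liftB_add_left, liftB_add_left, hx, hy, mul_add]
  | single w c =>
    induction z using MonoidAlgebra.induction_linear with
    | zero => simp [liftB_zero_right]
    | add x y hx hy => rw [liftB_add_right, liftB_add_right, hx, hy, mul_add]
    | single w' c' =>
      rw [lt_single, liftB_single, liftB_single, mul_smul_comm, ← prec_cons]
      rfl

lemma succH_lt (b : V) (x z : MonoidAlgebra k (FreeMonoid V)) :
    succH k x (lt k b * z) = lt k b * shH k x z := by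
  rw [succH_eq]
  unfold shH
  induction x using MonoidAlgebra.induction_linear with
  | zero => simp [liftB_zero_left]
  | add x y hx hy => rw [liftB_add_left, liftB_add_left, hx, hy, mul_add]
  | single w c =>
    induction z using MonoidAlgebra.induction_linear with
    | zero => simp [liftB_zero_right]
    | add x y hx hy => rw [mul_add, liftB_add_right, liftB_add_right, hx, hy, mul_add]
    | single w' c' =>
      rw [lt_single, liftB_single, liftB_single, mul_smul_comm, ← succ_cons]
      rfl

lemma shH_split_left (a : V) (x : List V) (z : MonoidAlgebra k (FreeMonoid V)) :
    shH k (wordElt k (a :: x)) z =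
      precH k (wordElt k (a :: x)) z + succH k (wordElt k (a :: x)) z := by
  rw [precH_eq, succH_eq]
  unfold shH
  induction z using MonoidAlgebra.induction_linear with
  | zero => simp [liftB_zero_right]
  | add x y hx hy => rw [liftB_add_right, liftB_add_right, liftB_add_right, hx, hy]; abel
  | single w c =>
    unfold wordElt
    rw [liftB_single, liftB_single, liftB_single, shuffle_split, smul_add]
    simp

lemma shH_split_right (a : V) (x : List V) (z : MonoidAlgebra k (FreeMonoid V)) :
    shH k z (wordElt k (a :: x)) =
      precH k z (wordElt k (a :: x)) + succH k z (wordElt k (a :: x)) := by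
  rw [precH_eq, succH_eq]
  unfold shH
  induction z using MonoidAlgebra.induction_linear with
  | zero => simp [liftB_zero_left]
  | add x y hx hy => rw [liftB_add_left, liftB_add_left, liftB_add_left, hx, hy]; abel
  | single w c =>
    unfold wordElt
    rw [liftB_single, liftB_single, liftB_single, shuffle_split, smul_add]
    simp

lemma shH_one_left (z : MonoidAlgebra k (FreeMonoid V)) : shH k (wordElt k []) z = z := by
  unfold shH
  induction z using MonoidAlgebra.induction_linear with
  | zero => simp [liftB_zero_right]
  | add x y hx hy => rw [liftB_add_right, hx, hy]
  | single w c =>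
    unfold wordElt
    rw [liftB_single, FreeMonoid.toList_ofList, shuffle_nil_left]
    simp [wordElt]

lemma shH_one_right (z : MonoidAlgebra k (FreeMonoid V)) : shH k z (wordElt k []) = z := by
  unfold shH
  induction z using MonoidAlgebra.induction_linear with
  | zero => simp [liftB_zero_left]
  | add x y hx hy => rw [liftB_add_left, hx, hy]
  | single w c =>
    unfold wordElt
    rw [liftB_single, FreeMonoid.toList_ofList, shuffle_nil_right]
    simp [wordElt]

def Assoc (x y z : List V) : Prop :=
  shH k (shuffleProd k x y) (wordElt k z) = shH k (wordElt k x) (shuffleProd k y z)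

lemma ax1 (a : V) (x y z : List V) (h : Assoc k x y z) :
    precH k (precOp k (a :: x) y) (wordElt k z) =
      precH k (wordElt k (a :: x)) (shuffleProd k y z) := by
  rw [prec_cons, precH_lt, h, ← lt_wordElt, precH_lt]

lemma ax2 (b : V) (x y z : List V) (h : Assoc k x y z) :
    precH k (succOp k x (b :: y)) (wordElt k z) =
      succH k (wordElt k x) (precOp k (b :: y) z) := by
  rw [succ_cons, precH_lt, h, prec_cons, succH_lt]

lemma ax3 (c : V) (x y z : List V) (h : Assoc k x y z) :
    succH k (shuffleProd k x y) (wordElt k (c :: z)) =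
      succH k (wordElt k x) (succOp k y (c :: z)) := by
  rw [succ_cons, succH_lt, ← h, ← lt_wordElt, succH_lt]

lemma precH_add_left (x x' y : MonoidAlgebra k (FreeMonoid V)) :
    precH k (x + x') y = precH k x y + precH k x' y := by
  simp only [precH_eq, liftB_add_left]

lemma succH_add_right (x y y' : MonoidAlgebra k (FreeMonoid V)) :
    succH k x (y + y') = succH k x y + succH k x y' := by
  simp only [succH_eq, liftB_add_right]

lemma assoc (x y z : List V) : Assoc k x y z := by
  match x, y, z with
  | [], y, z => 
    unfold Assoc
    rw [shuffle_nil_left, shH_one_left, shH_word]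
  | x, [], z => 
    unfold Assoc
    rw [shuffle_nil_left, shuffle_nil_right]
  | x, y, [] => 
    unfold Assoc
    rw [shuffle_nil_right, shH_one_right, shH_word]
  | a :: x, b :: y, c :: z =>
    have h1 := ax1 k a x (b :: y) (c :: z) (assoc _ _ _)
    have h2 := ax2 k b (a :: x) y (c :: z) (assoc _ _ _)
    have h3 := ax3 k c (a :: x) (b :: y) z (assoc _ _ _)
    unfold Assoc
    rw [shH_split_left, shH_split_right, h3, ← h1]
    rw [shuffle_split k (a :: x) (b :: y) (by simp), shuffle_split k (b :: y) (c :: z) (by simp),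
      precH_add_left, succH_add_right, h2]
    abel
termination_by x.length + y.length + z.length

end QS

/-- the horizontal dendriform structure. -/
theorem statement15 (x y z : List V) (hx : x ≠ []) (hy : y ≠ []) (hz : z ≠ []) :
    precH k (precOp k x y) (wordElt k z) = precH k (wordElt k x) (shuffleProd k y z) ∧
    precH k (succOp k x y) (wordElt k z) = succH k (wordElt k x) (precOp k y z) ∧
    succH k (shuffleProd k x y) (wordElt k z) = succH k (wordElt k x) (succOp k y z) := by
  obtain ⟨a, x, rfl⟩ := List.exists_cons_of_ne_nil hx
  obtain ⟨b, y, rfl⟩ := List.exists_cons_of_ne_nil hy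
  obtain ⟨c, z, rfl⟩ := List.exists_cons_of_ne_nil hz
  exact ⟨QS.ax1 k a x _ _ (QS.assoc k _ _ _), QS.ax2 k b _ y _ (QS.assoc k _ _ _),
    QS.ax3 k c _ _ z (QS.assoc k _ _ _)⟩
end

section
/- For all nonempty words u and v over V, the reduced deconcatenation of u ∨ v satisfies Δ'(u ∨ v) = Σ (u¹ ⧢ v¹) ⊗ (u² ∨ v²), where the sum runs over all pairs of cuts u = u¹u², v = v¹v² with (u², v²) ≠ (1, 1), and the operations on (possibly empty) factors follow the empty-word conventions (with 1⧢a = a⧢1 = a). -/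
open Finset MonoidAlgebra TensorProduct

variable (k : Type*) [CommRing k] {V : Type*}

/-- Deconcatenation coproduct `Δ(u) = Σ_{u = u¹u²} u¹ ⊗ u²`, extended `k`-linearly. -/
noncomputable def deconc (x : MonoidAlgebra k (FreeMonoid V)) :
    MonoidAlgebra k (FreeMonoid V) ⊗[k] MonoidAlgebra k (FreeMonoid V) :=
  Finsupp.sum x.coeff fun a ca =>
    ca • ∑ i ∈ Finset.range ((FreeMonoid.toList a).length + 1),
      (MonoidAlgebra.single (FreeMonoid.ofList ((FreeMonoid.toList a).take i)) (1 : k)) ⊗ₜ[k]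
        (MonoidAlgebra.single (FreeMonoid.ofList ((FreeMonoid.toList a).drop i)) (1 : k))

section Helpers

/-- Interleave two words along a mask (`true` = take a letter of the second word). -/
def mergeW {V : Type*} : List Bool → List V → List V → List V
  | [], _, _ => []
  | true :: m, u, b :: v => b :: mergeW m u v
  | true :: _, _, [] => []
  | false :: m, a :: u, v => a :: mergeW m u v
  | false :: _, [], _ => []

theorem mergeW_append {V : Type*} (m₁ m₂ : List Bool) (u v : List V)
    (h0 : m₁.count false ≤ u.length) (h1 : m₁.count true ≤ v.length) :
    mergeW (m₁ ++ m₂) u v =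
      mergeW m₁ (u.take (m₁.count false)) (v.take (m₁.count true)) ++
      mergeW m₂ (u.drop (m₁.count false)) (v.drop (m₁.count true)) := by
  induction m₁ generalizing u v with
  | nil => simp [mergeW]
  | cons b m ih =>
    cases b
    · cases u with
      | nil => simp at h0
      | cons a u =>
        simp at h0 h1
        simp [mergeW, ih u v h0 h1]
    · cases v with
      | nil => simp at h1
      | cons a v =>
        simp at h0 h1
        simp [mergeW, ih u v h0 h1]

theorem mergeW_length {V : Type*} (m : List Bool) (u v : List V)
    (h0 : m.count false ≤ u.length) (h1 : m.count true ≤ v.length) :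
    (mergeW m u v).length = m.length := by
  induction m generalizing u v with
  | nil => simp [mergeW]
  | cons b m ih =>
    cases b
    · cases u with
      | nil => simp at h0
      | cons a u =>
        simp at h0 h1
        simp [mergeW, ih u v h0 h1]
    · cases v with
      | nil => simp at h1
      | cons a v =>
        simp at h0 h1
        simp [mergeW, ih u v h0 h1]

theorem mergeW_get {V : Type*} (m : List Bool) (u v : List V) (i : ℕ) (b : Bool)
    (h0 : m.count false ≤ u.length) (h1 : m.count true ≤ v.length) (hb : m[i]? = some b) :
    (mergeW m u v)[i]? =
      if b then v[(m.take i).count true]? else u[(m.take i).count false]? := by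
  induction m generalizing u v i with
  | nil => simp at hb
  | cons c m ih =>
    cases c
    · cases u with
      | nil => simp at h0
      | cons a u =>
        simp at h0 h1
        cases i with
        | zero => simp at hb; subst hb; simp [mergeW]
        | succ i => simp at hb; simp [mergeW, ih u v i h0 h1 hb]
    · cases v with
      | nil => simp at h1
      | cons a v =>
        simp at h0 h1
        cases i with
        | zero => simp at hb; subst hb; simp [mergeW]
        | succ i => simp at hb; simp [mergeW, ih u v i h0 h1 hb]

theorem count_take_card (m : List Bool) (b : Bool) (i : ℕ) :
    (m.take i).count b = #{j ∈ range i | m[j]? = some b} := by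
  induction i with
  | zero => simp
  | succ i ih =>
    rw [List.take_add_one, List.count_append, ih, Finset.range_add_one, Finset.filter_insert]
    rcases h : m[i]? with _ | c
    · simp
    · by_cases hc : c = b <;> simp [hc]

theorem count_take_mono (m : List Bool) (b : Bool) {i j : ℕ} (h : i ≤ j) :
    (m.take i).count b ≤ (m.take j).count b := by
  rw [count_take_card, count_take_card]
  exact Finset.card_le_card (Finset.filter_subset_filter _ (by simpa using h))

theorem count_take_lt (m : List Bool) (b : Bool) {i j : ℕ} (h : i < j) (hb : m[i]? = some b) :
    (m.take i).count b < (m.take j).count b := by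
  have h1 : (m.take (i+1)).count b = (m.take i).count b + 1 := by
    rw [List.take_add_one, List.count_append, hb]; simp
  have := count_take_mono m b (Nat.succ_le_of_lt h)
  simp only [Nat.succ_eq_add_one] at this
  omega

theorem count_take_lt' (m : List Bool) (b : Bool) {i : ℕ} (hb : m[i]? = some b) :
    (m.take i).count b < m.count b := by
  have hi : i < m.length := (List.getElem?_eq_some_iff.1 hb).1
  have := count_take_lt m b hi hb
  simpa using this

/-- The mask of a permutation. -/
def maskOf (p q : ℕ) (σ : Equiv.Perm (Fin (p + q))) : List Bool :=
  List.ofFn fun i => decide (p ≤ (σ.symm i : ℕ))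

theorem maskOf_get (p q : ℕ) (σ : Equiv.Perm (Fin (p + q))) (i : Fin (p+q)) :
    (maskOf p q σ)[(i:ℕ)]? = some (decide (p ≤ (σ.symm i : ℕ))) := by
  simp [maskOf]

theorem maskOf_count_true (p q : ℕ) (σ : Equiv.Perm (Fin (p + q))) (hσ : IsSh p q σ)
    (i : Fin (p+q)) (hi : p ≤ (σ.symm i : ℕ)) :
    p + ((maskOf p q σ).take i).count true = (σ.symm i : ℕ) := by
  have : #(Finset.Ico p (σ.symm i : ℕ)) =
      #{j ∈ range i | (maskOf p q σ)[j]? = some true} := by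
    refine Finset.card_bij (fun a ha => (σ ⟨a, by simp at ha; omega⟩ : ℕ)) ?_ ?_ ?_
    · intro a ha
      simp only [Finset.mem_Ico] at ha
      simp only [Finset.mem_filter, Finset.mem_range, maskOf_get]
      have := hσ.2 ⟨a, by omega⟩ (σ.symm i) ha.1 ha.2
      simp at this
      refine ⟨this, by simp [ha.1]⟩
    · intro a ha b hb h
      simpa using σ.injective (Fin.ext h)
    · intro j hj
      simp only [Finset.mem_filter, Finset.mem_range] at hj
      have hjn : j < p + q := by omega
      have h2 := maskOf_get p q σ ⟨j, hjn⟩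
      simp only [hj.2] at h2
      simp at h2
      refine ⟨σ.symm ⟨j, hjn⟩, ?_, by simp⟩
      simp only [Finset.mem_Ico]
      refine ⟨h2, ?_⟩
      by_contra hc
      rcases Nat.lt_or_eq_of_le (Nat.le_of_not_lt hc) with h3 | h3
      · have := hσ.2 _ _ hi h3
        simp [Fin.lt_def] at this
        omega
      · have := σ.symm.injective (Fin.ext h3)
        simp [Fin.ext_iff] at this
        omega
  rw [count_take_card, ← this]
  simp; omega

theorem maskOf_count_false (p q : ℕ) (σ : Equiv.Perm (Fin (p + q))) (hσ : IsSh p q σ)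
    (i : Fin (p+q)) (hi : (σ.symm i : ℕ) < p) :
    ((maskOf p q σ).take i).count false = (σ.symm i : ℕ) := by
  have : #(Finset.range (σ.symm i : ℕ)) =
      #{j ∈ range i | (maskOf p q σ)[j]? = some false} := by
    refine Finset.card_bij (fun a ha => (σ ⟨a, by simp at ha; omega⟩ : ℕ)) ?_ ?_ ?_
    · intro a ha
      simp only [Finset.mem_range] at ha
      simp only [Finset.mem_filter, Finset.mem_range, maskOf_get]
      have := hσ.1 ⟨a, by omega⟩ (σ.symm i) ha hi
      simp at this
      refine ⟨this, by simp; omega⟩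
    · intro a ha b hb h
      simpa using σ.injective (Fin.ext h)
    · intro j hj
      simp only [Finset.mem_filter, Finset.mem_range] at hj
      have hjn : j < p + q := by omega
      have h2 := maskOf_get p q σ ⟨j, hjn⟩
      simp only [hj.2] at h2
      simp at h2
      refine ⟨σ.symm ⟨j, hjn⟩, ?_, by simp⟩
      simp only [Finset.mem_range]
      by_contra hc
      rcases Nat.lt_or_eq_of_le (Nat.le_of_not_lt hc) with h3 | h3
      · have := hσ.1 _ _ h3 h2
        simp [Fin.lt_def] at this
        omega
      · have := σ.symm.injective (Fin.ext h3)
        simp [Fin.ext_iff] at this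
        omega
  rw [count_take_card, ← this]
  simp

theorem maskOf_inj (p q : ℕ) (σ τ : Equiv.Perm (Fin (p + q))) (hσ : IsSh p q σ)
    (hτ : IsSh p q τ) (h : maskOf p q σ = maskOf p q τ) : σ = τ := by
  have : σ.symm = τ.symm := by
    ext i
    have h1 := maskOf_get p q σ i
    rw [h, maskOf_get] at h1
    simp only [Option.some.injEq, decide_eq_decide] at h1
    by_cases hi : p ≤ (σ.symm i : ℕ)
    · rw [← maskOf_count_true p q σ hσ i hi, ← maskOf_count_true p q τ hτ i (h1.2 hi), h]
    · rw [← maskOf_count_false p q σ hσ i (by omega),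
        ← maskOf_count_false p q τ hτ i (by omega), h]
  rw [← Equiv.symm_symm σ, this, Equiv.symm_symm]

theorem count_add (m : List Bool) : m.count false + m.count true = m.length := by
  induction m with
  | nil => rfl
  | cons b m ih => cases b <;> simp <;> omega

theorem maskOf_counts (p q : ℕ) (σ : Equiv.Perm (Fin (p + q))) :
    (maskOf p q σ).count false = p ∧ (maskOf p q σ).count true = q := by
  have hl : (maskOf p q σ).length = p + q := by simp [maskOf]
  have h1 : (maskOf p q σ).count false = p := by
    have := count_take_card (maskOf p q σ) false (p+q)
    rw [List.take_of_length_le hl.le] at this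
    rw [this]
    conv_rhs => rw [← Finset.card_range p]
    symm
    refine Finset.card_bij (fun a ha => (σ ⟨a, by simp at ha; omega⟩ : ℕ)) ?_ ?_ ?_
    · intro a ha
      simp only [Finset.mem_range] at ha
      simp only [Finset.mem_filter, Finset.mem_range, maskOf_get]
      refine ⟨Fin.is_lt _, by simp; omega⟩
    · intro a ha b hb h
      simpa using σ.injective (Fin.ext h)
    · intro j hj
      simp only [Finset.mem_filter, Finset.mem_range] at hj
      have hjn : j < p + q := by omega
      have h2 := maskOf_get p q σ ⟨j, hjn⟩
      simp only [hj.2] at h2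
      simp at h2
      exact ⟨σ.symm ⟨j, hjn⟩, by simpa using h2, by simp⟩
  have := count_add (maskOf p q σ)
  omega

theorem maskOf_surj (p q : ℕ) (m : List Bool) (h0 : m.count false = p) (h1 : m.count true = q) :
    ∃ σ, IsSh p q σ ∧ maskOf p q σ = m := by
  have hl : m.length = p + q := by rw [← count_add, h0, h1]
  let g : Fin (p+q) → ℕ := fun i =>
    if m[(i:ℕ)]? = some true then p + (m.take i).count true else (m.take i).count false
  have hc : ∀ i : Fin (p+q), m[(i:ℕ)]? = some true ∨ m[(i:ℕ)]? = some false := by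
    intro i
    have : (i:ℕ) < m.length := by omega
    rw [List.getElem?_eq_getElem this]
    rcases hcc : (m.get ⟨(i:ℕ), this⟩) with _ | _ <;> simp at hcc <;> simp [hcc]
  have gt : ∀ i : Fin (p+q), m[(i:ℕ)]? = some true →
      g i = p + (m.take i).count true ∧ g i < p + q := by
    intro i hi
    have := count_take_lt' m true hi
    have hg : g i = p + (m.take i).count true := by simp [g, hi]
    omega
  have gf : ∀ i : Fin (p+q), m[(i:ℕ)]? = some false →
      g i = (m.take i).count false ∧ g i < p := by
    intro i hi
    have := count_take_lt' m false hi
    simp [g, hi]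
    omega
  have glt : ∀ i, g i < p + q := by
    intro i
    rcases hc i with h | h
    · exact (gt i h).2
    · have := (gf i h).2; omega
  have gmono : ∀ i j : Fin (p+q), (p ≤ g i ↔ p ≤ g j) → i < j → g i < g j := by
    intro i j hij hlt
    rcases hc i with h | h <;> rcases hc j with h' | h'
    · have := count_take_lt m true (Fin.lt_def.1 hlt) h
      have := gt i h; have := gt j h'; omega
    · have := gt i h; have := gf j h'; omega
    · have := gf i h; have := gt j h'; omega
    · have := count_take_lt m false (Fin.lt_def.1 hlt) h
      have := gf i h; have := gf j h'; omega
  let f : Fin (p+q) → Fin (p+q) := fun i => ⟨g i, glt i⟩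
  have finj : Function.Injective f := by
    intro i j hij
    have hg : g i = g j := by simpa [f] using hij
    rcases lt_trichotomy i j with h | h | h
    · have := gmono i j (by rw [hg]) h; omega
    · exact h
    · have := gmono j i (by rw [hg]) h; omega
  let e : Equiv.Perm (Fin (p+q)) := Equiv.ofBijective f (Finite.injective_iff_bijective.1 finj)
  have he : ∀ i, ((e i : Fin (p+q)) : ℕ) = g i := fun i => rfl
  have key : ∀ i j : Fin (p+q), (i:ℕ) < j → (p ≤ (i:ℕ) ↔ p ≤ (j:ℕ)) → e.symm i < e.symm j := by
    intro i j hij hp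
    have hi := he (e.symm i)
    have hj := he (e.symm j)
    rw [Equiv.apply_symm_apply] at hi hj
    rcases lt_trichotomy (e.symm i) (e.symm j) with h | h | h
    · exact h
    · have := e.symm.injective h
      subst this; omega
    · have := gmono _ _ (by rw [← hi, ← hj]; exact hp.symm) h
      omega
  refine ⟨e.symm, ⟨fun i j h h' => key i j h (by omega), fun i j h h' => key i j h' (by omega)⟩, ?_⟩
  apply List.ext_getElem?
  intro i
  by_cases hi : i < p + q
  · rw [maskOf_get p q e.symm ⟨i, hi⟩, Equiv.symm_symm, he]
    rcases hc ⟨i, hi⟩ with h | h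
    · have := gt _ h
      simp only at h
      rw [h]; simp; omega
    · have := gf _ h
      simp only at h
      rw [h]; simp; omega
  · rw [List.getElem?_eq_none, List.getElem?_eq_none]
    · omega
    · simp [maskOf]; omega

theorem shWord_eq {V : Type*} (u v : List V) (σ : Equiv.Perm (Fin (u.length + v.length)))
    (hσ : IsSh u.length v.length σ) :
    shWord u v σ = FreeMonoid.ofList (mergeW (maskOf u.length v.length σ) u v) := by
  unfold shWord
  congr 1
  obtain ⟨h0, h1⟩ := maskOf_counts _ _ σ
  have hl := mergeW_length _ u v h0.le h1.le
  have hl' : (maskOf u.length v.length σ).length = u.length + v.length := by simp [maskOf]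
  apply List.ext_getElem?
  intro i
  by_cases hi : i < u.length + v.length
  · rw [mergeW_get _ u v i _ h0.le h1.le (maskOf_get _ _ σ ⟨i, hi⟩)]
    by_cases h : u.length ≤ (σ.symm ⟨i, hi⟩ : ℕ)
    · have := maskOf_count_true _ _ σ hσ ⟨i, hi⟩ h
      simp only at this
      have hcnt : ((maskOf u.length v.length σ).take i).count true =
          (σ.symm ⟨i, hi⟩ : ℕ) - u.length := by omega
      simp [h, hi, List.getElem_append, hcnt]
      rw [List.getElem?_eq_getElem (by omega), dif_neg (by omega)]
    · have := maskOf_count_false _ _ σ hσ ⟨i, hi⟩ (by omega)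
      simp only at this
      simp [h, hi, List.getElem_append, this]
      rw [List.getElem?_eq_getElem (by omega), dif_pos (by omega)]
  · rw [List.getElem?_eq_none, List.getElem?_eq_none]
    · omega
    · simp; omega

theorem masks_finite (p q : ℕ) :
    {m : List Bool | m.count false = p ∧ m.count true = q}.Finite := by
  refine (List.finite_length_eq Bool (p+q)).subset ?_
  rintro m ⟨h0, h1⟩
  show m.length = p + q
  rw [← count_add, h0, h1]

/-- Masks with `p` letters `false` and `q` letters `true`. -/
noncomputable def masks (p q : ℕ) : Finset (List Bool) := (masks_finite p q).toFinset

theorem mem_masks {p q : ℕ} {m : List Bool} :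
    m ∈ masks p q ↔ m.count false = p ∧ m.count true = q := by
  simp [masks]

/-- Masks ending in `true`. -/
noncomputable def vmasks (p q : ℕ) : Finset (List Bool) :=
  (masks p q).filter (fun m => m.getLast? = some true)

theorem mem_vmasks {p q : ℕ} {m : List Bool} :
    m ∈ vmasks p q ↔ (m.count false = p ∧ m.count true = q) ∧ m.getLast? = some true := by
  simp [vmasks, mem_masks]

theorem shuffleProd_eq (k : Type*) [CommRing k] {V : Type*} (u v : List V) :
    shuffleProd k u v = ∑ m ∈ masks u.length v.length,
      MonoidAlgebra.single (FreeMonoid.ofList (mergeW m u v)) (1 : k) := by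
  unfold shuffleProd
  refine Finset.sum_bij (fun σ _ => maskOf _ _ σ) ?_ ?_ ?_ ?_
  · intro σ _
    exact mem_masks.2 (maskOf_counts _ _ σ)
  · intro σ hσ τ hτ h
    exact maskOf_inj _ _ σ τ (Finset.mem_filter.1 hσ).2 (Finset.mem_filter.1 hτ).2 h
  · intro m hm
    obtain ⟨h0, h1⟩ := mem_masks.1 hm
    obtain ⟨σ, hσ, h⟩ := maskOf_surj _ _ m h0 h1
    exact ⟨σ, by simpa using hσ, h⟩
  · intro σ hσ
    rw [shWord_eq u v σ (Finset.mem_filter.1 hσ).2]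

theorem maskOf_last (p q : ℕ) (σ : Equiv.Perm (Fin (p + q))) :
    (maskOf p q σ).getLast? = some true ↔
      ∃ h : 0 < p + q, p ≤ (σ.symm ⟨p + q - 1, Nat.sub_lt h Nat.one_pos⟩ : ℕ) := by
  have hl : (maskOf p q σ).length = p + q := by simp [maskOf]
  rw [List.getLast?_eq_getElem?, hl]
  constructor
  · intro h
    have : p + q - 1 < (maskOf p q σ).length := (List.getElem?_eq_some_iff.1 h).1
    have h0 : 0 < p + q := by
      by_contra hc
      omega
    refine ⟨h0, ?_⟩
    have h2 := maskOf_get p q σ ⟨p+q-1, Nat.sub_lt h0 Nat.one_pos⟩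
    simp only [h] at h2
    simpa using h2
  · rintro ⟨h0, h⟩
    have h2 := maskOf_get p q σ ⟨p+q-1, Nat.sub_lt h0 Nat.one_pos⟩
    simp only at h2
    rw [h2]; simpa using h

theorem veeOp_eq (k : Type*) [CommRing k] {V : Type*} (u v : List V) :
    veeOp k u v = ∑ m ∈ vmasks u.length v.length,
      MonoidAlgebra.single (FreeMonoid.ofList (mergeW m u v)) (1 : k) := by
  unfold veeOp seOp swOp quadOp
  rw [← Finset.sum_union]
  · refine Finset.sum_bij (fun σ _ => maskOf _ _ σ) ?_ ?_ ?_ ?_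
    · intro σ hσ
      refine mem_vmasks.2 ⟨maskOf_counts _ _ σ, (maskOf_last _ _ σ).2 ?_⟩
      simp only [Finset.mem_union, Finset.mem_filter] at hσ
      rcases hσ with ⟨_, _, h, _, h'⟩ | ⟨_, _, h, _, h'⟩ <;> exact ⟨h, h'⟩
    · intro σ hσ τ hτ h
      simp only [Finset.mem_union, Finset.mem_filter] at hσ hτ
      exact maskOf_inj _ _ σ τ (by tauto) (by tauto) h
    · intro m hm
      obtain ⟨⟨h0, h1⟩, h2⟩ := mem_vmasks.1 hm
      obtain ⟨σ, hσ, h⟩ := maskOf_surj _ _ m h0 h1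
      refine ⟨σ, ?_, h⟩
      subst h
      obtain ⟨h3, h4⟩ := (maskOf_last _ _ σ).1 h2
      simp only [Finset.mem_union, Finset.mem_filter]
      rcases Nat.lt_or_ge (σ.symm ⟨0, h3⟩ : ℕ) u.length with h5 | h5
      · exact Or.inr ⟨Finset.mem_univ _, hσ, h3, h5, h4⟩
      · exact Or.inl ⟨Finset.mem_univ _, hσ, h3, h5, h4⟩
    · intro σ hσ
      simp only [Finset.mem_union, Finset.mem_filter] at hσ
      rw [shWord_eq u v σ (by tauto)]
  · rw [Finset.disjoint_left]
    intro σ h h'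
    simp only [Finset.mem_filter] at h h'
    obtain ⟨_, _, h1, h2, _⟩ := h
    obtain ⟨_, _, _, h3, _⟩ := h'
    simp only [posCond] at h2 h3
    omega

theorem deconc_single (k : Type*) [CommRing k] {V : Type*} (w : FreeMonoid V) :
    deconc k (MonoidAlgebra.single w (1 : k)) =
      ∑ i ∈ Finset.range ((FreeMonoid.toList w).length + 1),
      (MonoidAlgebra.single (FreeMonoid.ofList ((FreeMonoid.toList w).take i)) (1 : k)) ⊗ₜ[k]
        (MonoidAlgebra.single (FreeMonoid.ofList ((FreeMonoid.toList w).drop i)) (1 : k)) := by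
  unfold deconc
  rw [MonoidAlgebra.coeff_single, Finsupp.sum_single_index (by simp), one_smul]

theorem deconc_add (k : Type*) [CommRing k] {V : Type*} (x y : MonoidAlgebra k (FreeMonoid V)) :
    deconc k (x + y) = deconc k x + deconc k y := by
  unfold deconc
  rw [MonoidAlgebra.coeff_add]
  classical
  exact Finsupp.sum_add_index' (by simp) (by intros; rw [add_smul])

theorem deconc_sum (k : Type*) [CommRing k] {V ι : Type*} (s : Finset ι)
    (f : ι → MonoidAlgebra k (FreeMonoid V)) :
    deconc k (∑ i ∈ s, f i) = ∑ i ∈ s, deconc k (f i) := by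
  classical
  induction s using Finset.induction_on with
  | empty => simp [deconc]
  | insert a s ha ih => rw [Finset.sum_insert ha, Finset.sum_insert ha, deconc_add, ih]

end Helpers

/-- `Δ'(u ∨ v) = Σ (u¹ ⧢ v¹) ⊗ (u² ∨ v²)`, sum over pairs of cuts with
`(u², v²) ≠ (1, 1)`, where `Δ'(x) = Δ(x) - x ⊗ 1`. -/
theorem statement17 (u v : List V) (hu : u ≠ []) (hv : v ≠ []) :
    deconc k (veeOp k u v) -
        (veeOp k u v) ⊗ₜ[k] (MonoidAlgebra.single (FreeMonoid.ofList ([] : List V)) (1 : k)) =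
      ∑ p ∈ (Finset.range (u.length + 1) ×ˢ Finset.range (v.length + 1)).filter
          (fun p => ¬(p.1 = u.length ∧ p.2 = v.length)),
        (shuffleProd k (u.take p.1) (v.take p.2)) ⊗ₜ[k]
          (veeOp k (u.drop p.1) (v.drop p.2)) := by
  have hL : deconc k (veeOp k u v) -
        (veeOp k u v) ⊗ₜ[k] (MonoidAlgebra.single (FreeMonoid.ofList ([] : List V)) (1 : k)) =
      ∑ m ∈ vmasks u.length v.length, ∑ i ∈ Finset.range (u.length + v.length),
        (MonoidAlgebra.single (FreeMonoid.ofList ((mergeW m u v).take i)) (1 : k)) ⊗ₜ[k]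
        (MonoidAlgebra.single (FreeMonoid.ofList ((mergeW m u v).drop i)) (1 : k)) := by
    rw [veeOp_eq, deconc_sum, TensorProduct.sum_tmul, ← Finset.sum_sub_distrib]
    refine Finset.sum_congr rfl fun m hm => ?_
    obtain ⟨⟨h0, h1⟩, _⟩ := mem_vmasks.1 hm
    have hl : (mergeW m u v).length = u.length + v.length := by
      rw [mergeW_length m u v h0.le h1.le, ← count_add, h0, h1]
    rw [deconc_single, FreeMonoid.toList_ofList, hl, Finset.sum_range_succ,
      List.take_of_length_le hl.le, List.drop_of_length_le hl.le, add_sub_cancel_right]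
  rw [hL]
  simp_rw [shuffleProd_eq, veeOp_eq, TensorProduct.sum_tmul, TensorProduct.tmul_sum]
  simp_rw [← Finset.sum_product']
  rw [Finset.sum_sigma']
  refine Finset.sum_bij'
    (fun x _ => ⟨((x.1.take x.2).count false, (x.1.take x.2).count true),
      (x.1.take x.2, x.1.drop x.2)⟩)
    (fun y _ => (y.2.1 ++ y.2.2, y.2.1.length)) ?_ ?_ ?_ ?_ ?_
  · rintro ⟨m, i⟩ hx
    simp only [Finset.mem_product, mem_vmasks, Finset.mem_range] at hx
    obtain ⟨⟨⟨h0, h1⟩, h2⟩, hi⟩ := hx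
    have hl : m.length = u.length + v.length := by rw [← count_add, h0, h1]
    have e0 := List.count_append (a := false) (l₁ := m.take i) (l₂ := m.drop i)
    have e1 := List.count_append (a := true) (l₁ := m.take i) (l₂ := m.drop i)
    rw [List.take_append_drop] at e0 e1
    have e2 := count_add (m.take i)
    rw [List.length_take] at e2
    simp only [Finset.mem_sigma, Finset.mem_filter, Finset.mem_product, Finset.mem_range,
      mem_masks, mem_vmasks, List.length_take, List.length_drop]
    refine ⟨⟨⟨by omega, by omega⟩, by omega⟩, ⟨by omega, by omega⟩, ⟨by omega, by omega⟩, ?_⟩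
    rw [List.getLast?_drop, if_neg (by omega), h2]
  · rintro ⟨⟨a, b⟩, m₁, m₂⟩ hy
    simp only [Finset.mem_sigma, Finset.mem_filter, Finset.mem_product, Finset.mem_range,
      mem_masks, mem_vmasks, List.length_take, List.length_drop] at hy
    obtain ⟨⟨⟨ha, hb⟩, hab⟩, ⟨h0, h1⟩, ⟨h2, h3⟩, h4⟩ := hy
    simp only [Finset.mem_product, mem_vmasks, Finset.mem_range, List.count_append]
    have := count_add m₁
    refine ⟨⟨⟨by omega, by omega⟩, ?_⟩, by omega⟩
    rw [List.getLast?_append, h4]; rfl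
  · rintro ⟨m, i⟩ hx
    simp only [Finset.mem_product, mem_vmasks, Finset.mem_range] at hx
    obtain ⟨⟨⟨h0, h1⟩, h2⟩, hi⟩ := hx
    have hl : m.length = u.length + v.length := by rw [← count_add, h0, h1]
    simp only [List.take_append_drop, List.length_take]
    congr 1
    omega
  · rintro ⟨⟨a, b⟩, m₁, m₂⟩ hy
    simp only [Finset.mem_sigma, Finset.mem_filter, Finset.mem_product, Finset.mem_range,
      mem_masks, mem_vmasks, List.length_take, List.length_drop] at hy
    obtain ⟨⟨⟨ha, hb⟩, hab⟩, ⟨h0, h1⟩, ⟨h2, h3⟩, h4⟩ := hy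
    simp only [List.take_left, List.drop_left]
    have e0 : m₁.count false = a := by omega
    have e1 : m₁.count true = b := by omega
    rw [e0, e1]
  · rintro ⟨m, i⟩ hx
    simp only [Finset.mem_product, mem_vmasks, Finset.mem_range] at hx
    obtain ⟨⟨⟨h0, h1⟩, h2⟩, hi⟩ := hx
    have hl : m.length = u.length + v.length := by rw [← count_add, h0, h1]
    have e0 := List.count_append (a := false) (l₁ := m.take i) (l₂ := m.drop i)
    have e1 := List.count_append (a := true) (l₁ := m.take i) (l₂ := m.drop i)
    rw [List.take_append_drop] at e0 e1
    have hm := mergeW_append (m.take i) (m.drop i) u v (by omega) (by omega)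
    rw [List.take_append_drop] at hm
    have hlen := mergeW_length (m.take i) (u.take ((m.take i).count false))
      (v.take ((m.take i).count true)) (by rw [List.length_take]; omega)
      (by rw [List.length_take]; omega)
    rw [List.length_take] at hlen
    have hlen' : i = (mergeW (m.take i) (u.take ((m.take i).count false))
      (v.take ((m.take i).count true))).length := by omega
    have t1 : (mergeW m u v).take i = mergeW (m.take i) (u.take ((m.take i).count false))
      (v.take ((m.take i).count true)) := by
      rw [hm]; exact List.take_left' hlen'.symm
    have t2 : (mergeW m u v).drop i = mergeW (m.drop i) (u.drop ((m.take i).count false))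
      (v.drop ((m.take i).count true)) := by
      rw [hm]; exact List.drop_left' hlen'.symm
    simp only [t1, t2]
end
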